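/- arXiv:1304.0226 — 3 statements merged into one kernel-verified Lean document; each statement's English description precedes it below -/
import Mathlib

section
/- Let R and R' be semilocal rings (i.e. R/rad R and R'/rad R' are semisimple, hence isomorphic to finite direct products of matrix rings over fields). A bijection φ: ℙ(R) → ℙ(R') is a △-isomorphism if and only if φ is a ∥-isomorphism such that the induced bijection φ̄: ℙ(R/rad R) → ℙ(R'/rad R'), p̄ ↦ (φ(p))‾, is a △-isomorphism; equivalently, such that under identifications R/rad R ≅ ∏_{i=1}^m End_{K_i}(U_i) and R'/rad R' ≅ ∏_{j=1}^{m'} End_{K'_j}(U'_j), one has m = m' and there is a permutation σ of {1,…,m} with (φ̄(p))_{σ(k)} = φ_k(p_k) for △-isomorphisms φ_k: ℙ(End_{K_k}(U_k)) → ℙ(End_{K'_{σ(k)}}(U'_{σ(k)})) for all k and all p ∈ ℙ(R/rad R). -/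
/-- `p` is a point of the projective line over `R`. -/
def IsPoint (R : Type*) [Ring R] (p : Submodule R (R × R)) : Prop :=
  ∃ g : (Matrix (Fin 2) (Fin 2) R)ˣ,
    p = Submodule.span R {(g.val 0 0, g.val 0 1)}

/-- distant relation -/
def Distant {R : Type*} [Ring R] (p q : Submodule R (R × R)) : Prop :=
  ∃ g : (Matrix (Fin 2) (Fin 2) R)ˣ,
    p = Submodule.span R {(g.val 0 0, g.val 0 1)} ∧
    q = Submodule.span R {(g.val 1 0, g.val 1 1)}

/-- `△(p)`: the set of points distant to `p`. -/
def DistantSet {R : Type*} [Ring R] (p : Submodule R (R × R)) :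
    Set (Submodule R (R × R)) := {x | Distant x p}

/-- `p ∥ q` iff `△(p) ⊆ △(q)`. -/
def Parallel {R : Type*} [Ring R] (p q : Submodule R (R × R)) : Prop :=
  DistantSet p ⊆ DistantSet q

/-- `p ∼ q` via `r`: `r ∦ p`, `r ∦ q` and `△(r) ⊆ △(p) ∪ △(q)`. -/
def AdjacentVia {R : Type*} [Ring R] (p q r : Submodule R (R × R)) : Prop :=
  ¬ Parallel r p ∧ ¬ Parallel r q ∧ DistantSet r ⊆ DistantSet p ∪ DistantSet q

/-- `p ∼ q`: there is a point `r` with `p ∼ q` via `r`. -/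
def Adjacent {R : Type*} [Ring R] (p q : Submodule R (R × R)) : Prop :=
  ∃ r, IsPoint R r ∧ AdjacentVia p q r

/-- The `j`-th component projection `(Π R_i)² → (R j)²`, semilinear over evaluation. -/
def compMap {I : Type*} (R : I → Type*) [∀ i, Ring (R i)] (j : I) :
    ((Π i, R i) × (Π i, R i)) →ₛₗ[Pi.evalRingHom R j] (R j × R j) where
  toFun x := (x.1 j, x.2 j)
  map_add' _ _ := rfl
  map_smul' _ _ := rfl

instance {I : Type*} (R : I → Type*) [∀ i, Ring (R i)] (j : I) :
    RingHomSurjective (Pi.evalRingHom R j) :=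
  ⟨fun x => by classical exact ⟨Pi.single j x, Pi.single_eq_same j x⟩⟩

/-- The `j`-th component of a point of `ℙ(Π R_i)` under the canonical identification of
`ℙ(Π R_i)` with `Π ℙ(R_i)`: the image of `R(a,b)` is `R_j(a_j, b_j)`. -/
def component {I : Type*} {R : I → Type*} [∀ i, Ring (R i)]
    (p : Submodule (Π i, R i) ((Π i, R i) × (Π i, R i))) (j : I) :
    Submodule (R j) (R j × R j) :=
  Submodule.map (compMap R j) p

open MulOpposite

/-- The Jacobson radical of a ring: the intersection of all maximal left ideals. -/
def JacobsonRadical (R : Type*) [Ring R] : Set R :=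
  {a | ∀ I : Ideal R, I.IsMaximal → a ∈ I}

/-- `End_K(U)` with endomorphisms written on the right, as in the paper. -/
abbrev EndOp (K U : Type*) [DivisionRing K] [AddCommGroup U] [Module K U] :=
  (Module.End K U)ᵐᵒᵖ

/-- The projective line over `R` (as a type). -/
abbrev PL (R : Type*) [Ring R] := {p : Submodule R (R × R) // IsPoint R p}

/-- `f` is a `△`-isomorphism `ℙ(A) → ℙ(B)`. -/
def IsDisIso {A B : Type*} [Ring A] [Ring B]
    (f : Submodule A (A × A) → Submodule B (B × B)) : Prop :=
  Set.BijOn f {p | IsPoint A p} {q | IsPoint B q} ∧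
    ∀ p q, IsPoint A p → IsPoint A q → (Distant p q ↔ Distant (f p) (f q))

/-! ## Graph-theoretic part -/

/-- `P` and `Q` differ exactly in the coordinate `k`, where they are related by `e k`. -/
def CoordEdge {I : Type*} {X : I → Type*} (e : ∀ i, X i → X i → Prop) (k : I)
    (P Q : ∀ i, X i) : Prop :=
  e k (P k) (Q k) ∧ ∀ j, j ≠ k → P j = Q j

/-- The properties of a graph that make cartesian products of such graphs rigid: it is connected,
without loops or isolated vertices, and any two neighbours of a vertex `p` are joined by a path of
length at most two inside the neighbourhood of `p`. -/
structure LocallyConnectedGraph {X : Type*} (e : X → X → Prop) : Prop where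
  symm : ∀ {p q}, e p q → e q p
  irrefl : ∀ p, ¬ e p p
  exists_adj : ∀ p, ∃ q, e p q
  link : ∀ {p q q'}, e p q → e p q' → ∃ s, e p s ∧ (q = s ∨ e q s) ∧ (s = q' ∨ e s q')
  connected : ∀ p q, Relation.ReflTransGen e p q

section CartesianProduct

variable {I : Type*} {X : I → Type*} {e : ∀ i, X i → X i → Prop}

theorem CoordEdge.symm (he : ∀ i, LocallyConnectedGraph (e i)) {k : I} {P Q : ∀ i, X i}
    (h : CoordEdge e k P Q) : CoordEdge e k Q P :=
  ⟨(he k).symm h.1, fun j hj => (h.2 j hj).symm⟩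

theorem CoordEdge.apply_ne (he : ∀ i, LocallyConnectedGraph (e i)) {k : I} {P Q : ∀ i, X i}
    (h : CoordEdge e k P Q) : P k ≠ Q k := by
  intro hk
  have := h.1
  rw [hk] at this
  exact (he k).irrefl _ this

theorem CoordEdge.coord_unique (he : ∀ i, LocallyConnectedGraph (e i)) {k l : I}
    {P Q : ∀ i, X i} (h : CoordEdge e k P Q) (h' : CoordEdge e l P Q) : k = l := by
  by_contra hkl
  exact h.apply_ne he (h'.2 k hkl)

theorem coordEdge_update [DecidableEq I] {k : I} {P : ∀ i, X i} {x : X k} (h : e k (P k) x) :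
    CoordEdge e k P (Function.update P k x) := by
  refine ⟨by simpa using h, fun j hj => by simp [hj]⟩

/-- The three edges of a triangle in a cartesian product have the same coordinate. -/
theorem CoordEdge.triangle (he : ∀ i, LocallyConnectedGraph (e i)) {a b c : I}
    {P Q S : ∀ i, X i} (h₁ : CoordEdge e a P Q) (h₂ : CoordEdge e b P S)
    (h₃ : CoordEdge e c Q S) : a = b := by
  by_contra hab
  have hac : a = c := by
    by_contra hac
    exact h₁.apply_ne he ((h₂.2 a hab).trans (h₃.2 a hac).symm)
  have hbc : b = c := by
    by_contra hbc
    exact h₂.apply_ne he ((h₁.2 b (Ne.symm hab)).trans (h₃.2 b hbc))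
  exact hab (hac.trans hbc.symm)

theorem reflTransGen_coordEdge [DecidableEq I] (he : ∀ i, LocallyConnectedGraph (e i))
    (s : Finset I) : ∀ P Q : ∀ i, X i, (∀ j, j ∉ s → P j = Q j) →
      Relation.ReflTransGen (fun P Q => ∃ j ∈ s, CoordEdge e j P Q) P Q := by
  induction s using Finset.induction_on with
  | empty =>
    intro P Q h
    rw [funext fun j => h j (by simp)]
  | insert i s hi ih =>
    intro P Q h
    have h₁ : Relation.ReflTransGen (fun P Q => ∃ j ∈ insert i s, CoordEdge e j P Q) P
        (Function.update P i (Q i)) := by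
      have := Relation.ReflTransGen.lift
        (p := fun P Q => ∃ j ∈ insert i s, CoordEdge e j P Q) (Function.update P i)
        (fun x y hxy => ⟨i, Finset.mem_insert_self i s, by
          refine ⟨by simpa using hxy, fun j hj => by simp [hj]⟩⟩)
        _ _ ((he i).connected (P i) (Q i))
      simpa [Function.onFun] using this
    refine h₁.trans ?_
    refine Relation.ReflTransGen.mono ?_ _ _ (ih (Function.update P i (Q i)) Q ?_)
    · rintro P Q ⟨j, hj, hPQ⟩
      exact ⟨j, Finset.mem_insert_of_mem hj, hPQ⟩
    · intro j hj
      by_cases hji : j = i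
      · subst hji; simp
      · simpa [hji] using h j (by simp [hji, hj])

variable {J : Type*} {Y : J → Type*} {f : ∀ j, Y j → Y j → Prop}

/-- Edges at `P` with the same coordinate are mapped to edges with the same coordinate. -/
theorem exists_coord_map (he : ∀ i, LocallyConnectedGraph (e i))
    (hf : ∀ j, LocallyConnectedGraph (f j)) (Φ : (∀ i, X i) → ∀ j, Y j)
    (hΦ : ∀ P Q, (∃ k, CoordEdge e k P Q) → ∃ k, CoordEdge f k (Φ P) (Φ Q))
    (P : ∀ i, X i) (k : I) :
    ∃ k', ∀ Q, CoordEdge e k P Q → CoordEdge f k' (Φ P) (Φ Q) := by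
  classical
  obtain ⟨x, hx⟩ := (he k).exists_adj (P k)
  obtain ⟨k', hk'⟩ := hΦ _ _ ⟨k, coordEdge_update hx⟩
  have key : ∀ Q S a, CoordEdge e k P Q → CoordEdge e k P S → (Q k = S k ∨ e k (Q k) (S k)) →
      CoordEdge f a (Φ P) (Φ Q) → CoordEdge f a (Φ P) (Φ S) := by
    intro Q S a hQ hS hQS ha
    rcases hQS with h | h
    · have : Q = S := by
        funext j
        by_cases hj : j = k
        · subst hj; exact h
        · rw [← hQ.2 j hj, ← hS.2 j hj]
      rwa [← this]
    · obtain ⟨b, hb⟩ := hΦ _ _ ⟨k, hS⟩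
      obtain ⟨c, hc⟩ := hΦ Q S ⟨k, h, fun j hj => by rw [← hQ.2 j hj, ← hS.2 j hj]⟩
      rwa [ha.triangle hf hb hc]
  refine ⟨k', fun Q hQ => ?_⟩
  obtain ⟨s, hs, h₁, h₂⟩ := (he k).link hx hQ.1
  have hS : CoordEdge e k P (Function.update P k s) := coordEdge_update hs
  refine key _ Q k' hS hQ (by simpa using h₂) (key _ _ k' (coordEdge_update hx) hS ?_ hk')
  simpa using h₁

/-- In a square with sides of distinct coordinates, opposite sides have the same coordinate. -/
theorem CoordEdge.square (hf : ∀ j, LocallyConnectedGraph (f j)) {a b c d : J}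
    {P P' Q Q' : ∀ j, Y j} (h₁ : CoordEdge f a P P') (h₂ : CoordEdge f b P Q)
    (h₃ : CoordEdge f c P' Q') (h₄ : CoordEdge f d Q Q') (hab : a ≠ b) (hne : Q' ≠ P) :
    b = c := by
  by_contra hbc
  have hb : Q b ≠ Q' b := by
    rw [← h₃.2 b hbc, ← h₁.2 b (Ne.symm hab)]
    exact (h₂.apply_ne hf).symm
  have hd : b = d := by
    by_contra hbd
    exact hb (h₄.2 b hbd)
  subst hd
  have hQa : Q' a = P a := by rw [← h₄.2 a hab, ← h₂.2 a hab]
  have hac : a = c := by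
    by_contra hac
    exact h₁.apply_ne hf (by rw [h₃.2 a hac, hQa])
  subst hac
  refine hne (funext fun j => ?_)
  by_cases hj : j = a
  · subst hj; exact hQa
  · rw [← h₃.2 j hj, ← h₁.2 j hj]

theorem exists_coord_map_const [Finite I] [Nonempty (∀ i, X i)]
    (he : ∀ i, LocallyConnectedGraph (e i))
    (hf : ∀ j, LocallyConnectedGraph (f j)) (Φ : (∀ i, X i) ≃ ∀ j, Y j)
    (hΦ : ∀ P Q, (∃ k, CoordEdge e k P Q) ↔ ∃ k, CoordEdge f k (Φ P) (Φ Q)) :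
    ∃ τ : I → J, ∀ k P Q, CoordEdge e k P Q → CoordEdge f (τ k) (Φ P) (Φ Q) := by
  classical
  have := Fintype.ofFinite I
  choose t ht using exists_coord_map he hf Φ (fun P Q => (hΦ P Q).1)
  have hΦ' : ∀ P Q, (∃ k, CoordEdge f k P Q) → ∃ k, CoordEdge e k (Φ.symm P) (Φ.symm Q) := by
    intro P Q h
    rw [hΦ]
    simpa using h
  have hinj : ∀ P j k, t P j = t P k → j = k := by
    intro P j k hjk
    obtain ⟨x, hx⟩ := (he j).exists_adj (P j)
    obtain ⟨y, hy⟩ := (he k).exists_adj (P k)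
    have hx := coordEdge_update hx
    have hy := coordEdge_update hy
    obtain ⟨l, hl⟩ := exists_coord_map hf he Φ.symm hΦ' (Φ P) (t P j)
    have h₁ := hl _ (ht _ _ _ hx)
    have h₂ := hl _ (hjk ▸ ht _ _ _ hy)
    simp only [Equiv.symm_apply_apply] at h₁ h₂
    exact (hx.coord_unique he h₁).trans (hy.coord_unique he h₂).symm
  have hstep : ∀ P P', (∃ j ∈ Finset.univ, CoordEdge e j P P') → t P = t P' := by
    rintro P P' ⟨j, -, hj⟩
    funext k
    by_cases hjk : j = k
    · subst hjk
      exact (ht _ _ _ hj).coord_unique hf ((ht _ _ _ (hj.symm he)).symm hf)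
    · obtain ⟨x, hx⟩ := (he k).exists_adj (P k)
      have hx' : e k (P' k) x := by rwa [← hj.2 k (Ne.symm hjk)]
      have hQ := coordEdge_update hx
      have hQ' := coordEdge_update hx'
      have hQQ' : CoordEdge e j (Function.update P k x) (Function.update P' k x) := by
        refine ⟨by simpa [hjk] using hj.1, fun i hi => ?_⟩
        by_cases hik : i = k
        · subst hik; simp
        · simpa [hik] using hj.2 i hi
      obtain ⟨d, hd⟩ := (hΦ _ _).1 ⟨j, hQQ'⟩
      refine CoordEdge.square hf (ht _ _ _ hj) (ht _ _ _ hQ) (ht _ _ _ hQ') hd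
        (fun h => hjk (hinj _ _ _ h)) ?_
      intro h
      have := congrFun (Φ.injective h) j
      rw [Function.update_of_ne hjk] at this
      exact hj.apply_ne he this.symm
  obtain ⟨P₀⟩ := ‹Nonempty (∀ i, X i)›
  refine ⟨t P₀, fun k P Q h => ?_⟩
  have hP : t P₀ = t P := by
    have := reflTransGen_coordEdge he Finset.univ P₀ P (by simp)
    clear h
    induction this with
    | refl => rfl
    | tail _ h ih => exact ih.trans (hstep _ _ h)
  rw [hP]
  exact ht _ _ _ h

/-- Isomorphisms between cartesian products permute the coordinates. -/
theorem exists_coord_equiv [Finite I] [Finite J] [Nonempty (∀ i, X i)]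
    (he : ∀ i, LocallyConnectedGraph (e i))
    (hf : ∀ j, LocallyConnectedGraph (f j)) (Φ : (∀ i, X i) ≃ ∀ j, Y j)
    (hΦ : ∀ P Q, (∃ k, CoordEdge e k P Q) ↔ ∃ k, CoordEdge f k (Φ P) (Φ Q)) :
    ∃ σ : I ≃ J, ∀ k P Q, P k = Q k → Φ P (σ k) = Φ Q (σ k) := by
  classical
  have := Fintype.ofFinite I
  have hne : Nonempty (∀ j, Y j) := ‹Nonempty (∀ i, X i)›.map Φ
  have hΦ' : ∀ P Q, (∃ k, CoordEdge f k P Q) ↔ ∃ k, CoordEdge e k (Φ.symm P) (Φ.symm Q) := by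
    intro P Q
    rw [hΦ]
    simp
  obtain ⟨τ, hτ⟩ := exists_coord_map_const he hf Φ hΦ
  obtain ⟨τ', hτ'⟩ := exists_coord_map_const hf he Φ.symm hΦ'
  have h₁ : ∀ k, τ' (τ k) = k := by
    intro k
    obtain ⟨P⟩ := ‹Nonempty (∀ i, X i)›
    obtain ⟨x, hx⟩ := (he k).exists_adj (P k)
    have hx := coordEdge_update hx
    have h := hτ' _ _ _ (hτ _ _ _ hx)
    simp only [Equiv.symm_apply_apply] at h
    exact h.coord_unique he hx
  have h₂ : ∀ k, τ (τ' k) = k := by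
    intro k
    obtain ⟨P⟩ := hne
    obtain ⟨x, hx⟩ := (hf k).exists_adj (P k)
    have hx := coordEdge_update hx
    have h := hτ _ _ _ (hτ' _ _ _ hx)
    simp only [Equiv.apply_symm_apply] at h
    exact h.coord_unique hf hx
  refine ⟨⟨τ, τ', h₁, h₂⟩, fun k P Q hPQ => ?_⟩
  have := reflTransGen_coordEdge he (Finset.univ.erase k) P Q (by
    intro j hj
    have : j = k := by simpa using hj
    subst this; exact hPQ)
  clear hPQ
  induction this with
  | refl => rfl
  | tail _ h ih =>
    obtain ⟨j, hj, hPQ⟩ := h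
    refine ih.trans ((hτ _ _ _ hPQ).2 _ ?_)
    intro h
    have : k = j := by rw [← h₁ k, ← h₁ j]; exact congrArg τ' h
    simp [this] at hj

end CartesianProduct

/-! ## Distant graphs -/

/-- Every vertex distant to `r` is distant to `p` or to some fixed vertex `q`, where `p, q ≠ r`. -/
def DistAdj {X : Type*} (d : X → X → Prop) (r p : X) : Prop :=
  p ≠ r ∧ ∃ q, q ≠ r ∧ ∀ c, d c r → d c p ∨ d c q

/-- The properties of the distant relation on the projective line over the endomorphism ring of
a finite-dimensional vector space that are needed to recover the factors of a product. -/
structure IsRigidDistant {X : Type*} (d : X → X → Prop) : Prop where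
  nonempty : Nonempty X
  exists_dist : ∀ p, ∃ c, d c p
  eq_of_subset : ∀ p q, (∀ c, d c p → d c q) → p = q
  graph : LocallyConnectedGraph (DistAdj d)

theorem distAdj_equiv_iff {X Y : Type*} {d : X → X → Prop} {d' : Y → Y → Prop} (Φ : X ≃ Y)
    (hΦ : ∀ p q, d p q ↔ d' (Φ p) (Φ q)) (r p : X) :
    DistAdj d r p ↔ DistAdj d' (Φ r) (Φ p) := by
  simp only [DistAdj, ← Φ.exists_congr_right, ← Φ.forall_congr_right, ← hΦ, ne_eq,
    Φ.injective.eq_iff]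

theorem IsRigidDistant.of_equiv {X Y : Type*} {d : X → X → Prop} {d' : Y → Y → Prop} (Φ : X ≃ Y)
    (hΦ : ∀ p q, d p q ↔ d' (Φ p) (Φ q)) (h : IsRigidDistant d) : IsRigidDistant d' := by
  have hA := distAdj_equiv_iff Φ hΦ
  refine ⟨h.nonempty.map Φ, ?_, ?_, ⟨?_, ?_, ?_, ?_, ?_⟩⟩
  · rw [← Φ.forall_congr_right]
    intro p
    obtain ⟨c, hc⟩ := h.exists_dist p
    exact ⟨Φ c, (hΦ _ _).1 hc⟩
  · simp only [← Φ.forall_congr_right, ← hΦ, Φ.injective.eq_iff]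
    exact h.eq_of_subset
  · intro p q
    rw [← Φ.apply_symm_apply p, ← Φ.apply_symm_apply q, ← hA, ← hA]
    exact h.graph.symm
  · intro p
    rw [← Φ.apply_symm_apply p, ← hA]
    exact h.graph.irrefl _
  · intro p
    obtain ⟨q, hq⟩ := h.graph.exists_adj (Φ.symm p)
    refine ⟨Φ q, ?_⟩
    rwa [hA, Φ.apply_symm_apply] at hq
  · intro p q q' h₁ h₂
    rw [← Φ.apply_symm_apply p, ← Φ.apply_symm_apply q, ← hA] at h₁
    rw [← Φ.apply_symm_apply p, ← Φ.apply_symm_apply q', ← hA] at h₂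
    obtain ⟨s, hs, hs₁, hs₂⟩ := h.graph.link h₁ h₂
    refine ⟨Φ s, by simpa [hA] using hs, ?_, ?_⟩
    · simpa [hA, Equiv.symm_apply_eq] using hs₁
    · simpa [hA, Equiv.eq_symm_apply] using hs₂
  · intro p q
    have := Relation.ReflTransGen.lift (p := DistAdj d') Φ (fun a b => (hA a b).1)
      _ _ (h.graph.connected (Φ.symm p) (Φ.symm q))
    simpa [Function.onFun] using this

section DistantProduct

variable {I : Type*} {X : I → Type*} {d : ∀ i, X i → X i → Prop}

theorem eq_of_subset_pi (hd : ∀ i, IsRigidDistant (d i)) (P Q : ∀ i, X i)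
    (h : ∀ C : ∀ i, X i, (∀ i, d i (C i) (P i)) → ∀ i, d i (C i) (Q i)) : P = Q := by
  classical
  choose c hc using fun i => (hd i).exists_dist (P i)
  funext i
  refine (hd i).eq_of_subset _ _ fun x hx => ?_
  have := h (Function.update c i x) (fun j => ?_) i
  · simpa using this
  · by_cases hj : j = i
    · subst hj; simpa using hx
    · simpa [hj] using hc j

/-- Adjacency in a product of distant graphs takes place in a single coordinate. -/
theorem distAdj_pi_iff (hd : ∀ i, IsRigidDistant (d i)) (R P : ∀ i, X i) :
    DistAdj (fun P Q : ∀ i, X i => ∀ i, d i (P i) (Q i)) R P ↔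
      ∃ k, CoordEdge (fun i => DistAdj (d i)) k R P := by
  classical
  choose c hc using fun i => (hd i).exists_dist (R i)
  constructor
  · rintro ⟨hPR, Q, hQR, h⟩
    have hsep : ∀ i (x : X i), x ≠ R i → ∃ y, d i y (R i) ∧ ¬ d i y x := by
      intro i x hx
      by_contra! hcon
      exact hx ((hd i).eq_of_subset _ _ hcon).symm
    have hij : ∀ i j, P i ≠ R i → Q j ≠ R j → i = j := by
      intro i j hi hj
      by_contra hne
      obtain ⟨x, hx, hx'⟩ := hsep i _ hi
      obtain ⟨y, hy, hy'⟩ := hsep j _ hj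
      have hC : ∀ l, d l (Function.update (Function.update c i x) j y l) (R l) := by
        intro l
        by_cases hl : l = j
        · subst hl; simpa using hy
        · by_cases hl' : l = i
          · subst hl'; simpa [hl] using hx
          · simpa [hl, hl'] using hc l
      rcases h _ hC with h | h
      · exact hx' (by simpa [hne] using h i)
      · exact hy' (by simpa using h j)
    obtain ⟨k, hk⟩ := Function.ne_iff.1 hPR
    obtain ⟨l, hl⟩ := Function.ne_iff.1 hQR
    obtain rfl := hij k l hk hl
    refine ⟨k, ⟨hk, Q k, hl, fun x hx => ?_⟩, fun j hj => ?_⟩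
    · refine (h (Function.update c k x) (fun l => ?_)).imp (fun h => ?_) (fun h => ?_)
      · by_cases hl : l = k
        · subst hl; simpa using hx
        · simpa [hl] using hc l
      · simpa using h k
      · simpa using h k
    · by_contra hne
      exact hj (hij j k (Ne.symm hne) hl)
  · rintro ⟨k, ⟨hk, q, hq, h⟩, hoff⟩
    refine ⟨fun h => hk (congrFun h k), Function.update R k q, fun h => hq ?_, fun C hC => ?_⟩
    · simpa using congrFun h k
    · refine (h (C k) (hC k)).imp (fun h j => ?_) (fun h j => ?_)
      · by_cases hj : j = k
        · subst hj; exact h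
        · rw [← hoff j hj]; exact hC j
      · by_cases hj : j = k
        · subst hj; simpa using h
        · simpa [hj] using hC j

variable {J : Type*} {Y : J → Type*} {d' : ∀ j, Y j → Y j → Prop}

/-- Distant-isomorphisms between products are products of distant-isomorphisms of the factors, up
to a permutation of the factors. -/
theorem exists_factorization [Finite I] [Finite J] (hd : ∀ i, IsRigidDistant (d i))
    (hd' : ∀ j, IsRigidDistant (d' j)) (Φ : (∀ i, X i) ≃ ∀ j, Y j)
    (hΦ : ∀ P Q, (∀ i, d i (P i) (Q i)) ↔ ∀ j, d' j (Φ P j) (Φ Q j)) :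
    ∃ (σ : I ≃ J) (φ : ∀ k, X k → Y (σ k)), (∀ k, Function.Bijective (φ k)) ∧
      (∀ k x y, d k x y ↔ d' (σ k) (φ k x) (φ k y)) ∧ ∀ P k, Φ P (σ k) = φ k (P k) := by
  classical
  have : Nonempty (∀ i, X i) := Classical.nonempty_pi.2 fun i => (hd i).nonempty
  have hE : ∀ P Q : ∀ i, X i, (∃ k, CoordEdge (fun i => DistAdj (d i)) k P Q) ↔
      ∃ k, CoordEdge (fun j => DistAdj (d' j)) k (Φ P) (Φ Q) := by
    intro P Q
    rw [← distAdj_pi_iff hd, ← distAdj_pi_iff hd']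
    exact distAdj_equiv_iff Φ hΦ P Q
  obtain ⟨σ, hσ⟩ := exists_coord_equiv (fun i => (hd i).graph) (fun j => (hd' j).graph) Φ hE
  obtain ⟨P₀⟩ := this
  have hcomp : ∀ P k, Φ P (σ k) = Φ (Function.update P₀ k (P k)) (σ k) :=
    fun P k => hσ k _ _ (by simp)
  choose c hc using fun i => (hd i).exists_dist (P₀ i)
  have hdist : ∀ k x y, d k x y →
      d' (σ k) (Φ (Function.update P₀ k x) (σ k)) (Φ (Function.update P₀ k y) (σ k)) := by
    intro k x y hxy
    have := (hΦ (Function.update c k x) (Function.update P₀ k y)).1 (fun i => ?_) (σ k)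
    · rw [hcomp] at this
      simpa using this
    · by_cases hi : i = k
      · subst hi; simpa using hxy
      · simpa [hi] using hc i
  refine ⟨σ, fun k x => Φ (Function.update P₀ k x) (σ k), fun k => ⟨fun x y hxy => ?_, fun y => ?_⟩,
    fun k x y => ⟨hdist k x y, fun h => ?_⟩, hcomp⟩
  · have : Φ (Function.update P₀ k x) = Φ (Function.update P₀ k y) := by
      funext j
      obtain ⟨i, rfl⟩ := σ.surjective j
      by_cases hi : i = k
      · subst hi; exact hxy
      · exact hσ i _ _ (by simp [hi])
    simpa using congrFun (Φ.injective this) k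
  · obtain ⟨Q₀⟩ := Classical.nonempty_pi.2 fun j => (hd' j).nonempty
    refine ⟨Φ.symm (Function.update Q₀ (σ k) y) k, ?_⟩
    dsimp only
    rw [← hcomp]
    simp
  · have := (hΦ (Function.update c k x) (Function.update P₀ k y)).2 (fun j => ?_) k
    · simpa using this
    · obtain ⟨i, rfl⟩ := σ.surjective j
      rw [hcomp, hcomp (Function.update P₀ k y)]
      by_cases hi : i = k
      · subst hi; simpa using h
      · simpa [hi] using hdist i _ _ (hc i)

end DistantProduct

/-! ## Grassmannians -/

section Grassmannian

open Module

variable {K V : Type*} [DivisionRing K] [AddCommGroup V] [Module K V]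

theorem notMem_inf_left {p q : Submodule K V} {x : V} (hx : x ∉ p) : x ∉ p ⊓ q :=
  fun h => hx h.1

theorem disjoint_span_singleton_of_notMem {p : Submodule K V} {x : V} (hx : x ∉ p) :
    Disjoint (K ∙ x) p := by
  rw [Submodule.disjoint_def]
  intro y hy hyp
  obtain ⟨a, rfl⟩ := Submodule.mem_span_singleton.1 hy
  by_cases ha : a = 0
  · simp [ha]
  · exact absurd ((p.smul_mem_iff ha).1 hyp) hx

variable [FiniteDimensional K V]

theorem finrank_sup_span_singleton_of_notMem {p : Submodule K V} {x : V} (hx : x ∉ p) :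
    finrank K (p ⊔ K ∙ x : Submodule K V) = finrank K p + 1 := by
  have h := Submodule.finrank_sup_add_finrank_inf_eq p (K ∙ x)
  rw [(disjoint_span_singleton_of_notMem hx).symm.eq_bot, finrank_bot,
    finrank_span_singleton (by rintro rfl; exact hx p.zero_mem)] at h
  simpa using h

/-- A hyperplane of `p` that contains a given subspace and avoids a given vector. -/
theorem exists_hyperplane_notMem {p D : Submodule K V} {x : V} (hD : D ≤ p) (hx : x ∈ p)
    (hxD : x ∉ D) :
    ∃ H ≤ p, D ≤ H ∧ x ∉ H ∧ finrank K H + 1 = finrank K p := by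
  obtain ⟨c, hc, hcx⟩ := (disjoint_span_singleton_of_notMem hxD).symm.exists_isCompl
  have hx0 : x ≠ 0 := fun h => hxD (h ▸ D.zero_mem)
  refine ⟨p ⊓ c, inf_le_left, le_inf hD hc, fun h => hx0 ?_, ?_⟩
  · exact Submodule.disjoint_def.1 hcx.disjoint x h.2 (Submodule.mem_span_singleton_self x)
  · have h₁ := Submodule.finrank_sup_add_finrank_inf_eq p c
    have h₂ := Submodule.finrank_add_eq_of_isCompl hcx
    have h₃ : p ⊔ c = ⊤ := by
      rw [eq_top_iff, ← hcx.sup_eq_top]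
      exact sup_le le_sup_right (le_sup_of_le_left (by simpa using hx))
    rw [h₃, finrank_top] at h₁
    rw [finrank_span_singleton hx0] at h₂
    omega

variable {n : ℕ}

theorem exists_mem_notMem_of_finrank_eq {p q : Submodule K V} (hp : finrank K p = n)
    (hq : finrank K q = n) (hpq : p ≠ q) : ∃ x ∈ p, x ∉ q := by
  by_contra! h
  exact hpq (Submodule.eq_of_le_of_finrank_eq h (hp.trans hq.symm))

theorem isCompl_of_disjoint_of_finrank (hV : finrank K V = n + n) {p q : Submodule K V}
    (hp : finrank K p = n) (hq : finrank K q = n) (h : Disjoint p q) : IsCompl p q := by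
  refine ⟨h, codisjoint_iff.2 ?_⟩
  apply Submodule.eq_top_of_finrank_eq
  have := Submodule.finrank_sup_add_finrank_inf_eq p q
  rw [h.eq_bot, finrank_bot] at this
  omega

theorem exists_isCompl_of_disjoint (hV : finrank K V = n + n) {p D : Submodule K V}
    (hp : finrank K p = n) (h : Disjoint D p) :
    ∃ c : Submodule K V, finrank K c = n ∧ D ≤ c ∧ IsCompl c p := by
  obtain ⟨c, hDc, hc⟩ := h.exists_isCompl
  have := Submodule.finrank_add_eq_of_isCompl hc
  exact ⟨c, by omega, hDc, hc⟩

variable (K V n) in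
/-- The Grassmannian of `n`-dimensional subspaces. -/
abbrev Grass := {p : Submodule K V // finrank K p = n}

/-- Complementarity of subspaces. -/
abbrev Grass.Compl (p q : Grass K V n) : Prop := IsCompl p.1 q.1

theorem Grass.eq_of_subset (hV : finrank K V = n + n) (p q : Grass K V n)
    (h : ∀ c : Grass K V n, c.Compl p → c.Compl q) : p = q := by
  by_contra hne
  obtain ⟨x, hxq, hxp⟩ := exists_mem_notMem_of_finrank_eq q.2 p.2
    (fun h => hne (Subtype.ext h.symm))
  obtain ⟨c, hcn, hxc, hc⟩ := exists_isCompl_of_disjoint hV p.2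
    (disjoint_span_singleton_of_notMem hxp)
  have hx0 := Submodule.disjoint_def.1 (h ⟨c, hcn⟩ hc).disjoint x (by simpa using hxc) hxq
  exact hxp (hx0 ▸ p.1.zero_mem)

/-- Two subspaces are adjacent with respect to complementarity if and only if they are distinct
and meet in a hyperplane. -/
theorem Grass.distAdj_iff (hV : finrank K V = n + n) (r p : Grass K V n) :
    DistAdj Grass.Compl r p ↔ p ≠ r ∧ n ≤ finrank K (r.1 ⊓ p.1 : Submodule K V) + 1 := by
  refine and_congr_right fun hne => ⟨?_, ?_⟩
  · rintro ⟨q, hqr, h⟩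
    obtain ⟨y, hyq, hyr⟩ := exists_mem_notMem_of_finrank_eq q.2 r.2
      (fun h => hqr (Subtype.ext h))
    have hle : r.1 ⊔ p.1 ≤ r.1 ⊔ K ∙ y := by
      refine sup_le le_sup_left fun x hxp => ?_
      by_contra hx
      have hxr : x ∉ r.1 := fun h => hx (Submodule.mem_sup_left h)
      have hdis : Disjoint ((K ∙ x) ⊔ K ∙ y) r.1 := by
        rw [Submodule.disjoint_def]
        intro z hz hzr
        obtain ⟨u, hu, v, hv, rfl⟩ := Submodule.mem_sup.1 hz
        obtain ⟨a, rfl⟩ := Submodule.mem_span_singleton.1 hu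
        obtain ⟨b, rfl⟩ := Submodule.mem_span_singleton.1 hv
        have hax : a • x ∈ r.1 ⊔ K ∙ y := by
          have : a • x = (a • x + b • y) - b • y := by abel
          rw [this]
          exact Submodule.sub_mem _ (Submodule.mem_sup_left hzr)
            (Submodule.mem_sup_right (Submodule.smul_mem _ _ (Submodule.mem_span_singleton_self y)))
        have ha : a = 0 := by
          by_contra ha
          exact hx ((Submodule.smul_mem_iff _ ha).1 hax)
        have hb : b = 0 := by
          by_contra hb
          rw [ha, zero_smul, zero_add] at hzr
          exact hyr ((Submodule.smul_mem_iff _ hb).1 hzr)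
        simp [ha, hb]
      obtain ⟨c, hcn, hDc, hc⟩ := exists_isCompl_of_disjoint hV r.2 hdis
      have hxc : x ∈ c := hDc (Submodule.mem_sup_left (Submodule.mem_span_singleton_self x))
      have hyc : y ∈ c := hDc (Submodule.mem_sup_right (Submodule.mem_span_singleton_self y))
      rcases h ⟨c, hcn⟩ hc with h | h
      · exact hxr (Submodule.disjoint_def.1 h.disjoint x hxc hxp ▸ r.1.zero_mem)
      · exact hyr (Submodule.disjoint_def.1 h.disjoint y hyc hyq ▸ r.1.zero_mem)
    have h₁ := Submodule.finrank_mono hle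
    have h₂ := Submodule.finrank_sup_add_finrank_inf_eq r.1 p.1
    rw [finrank_sup_span_singleton_of_notMem hyr] at h₁
    rw [r.2, p.2] at h₂
    rw [r.2] at h₁
    omega
  · intro hn
    have hne' : p.1 ≠ r.1 := fun h => hne (Subtype.ext h)
    obtain ⟨x, hxr, hxp⟩ := exists_mem_notMem_of_finrank_eq r.2 p.2 hne'.symm
    obtain ⟨y, hyp, hyr⟩ := exists_mem_notMem_of_finrank_eq p.2 r.2 hne'
    have hlt : finrank K (r.1 ⊓ p.1 : Submodule K V) + 1 = n := by
      have hlt : r.1 ⊓ p.1 < r.1 :=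
        lt_of_le_of_ne inf_le_left (fun h => hxp (inf_eq_left.1 h hxr))
      have := Submodule.finrank_lt_finrank_of_lt hlt
      have := r.2
      omega
    have hxy : x + y ∉ r.1 := fun h => hyr ((r.1.add_mem_iff_right hxr).1 h)
    have hpy : p.1 = r.1 ⊓ p.1 ⊔ K ∙ y := by
      refine (Submodule.eq_of_le_of_finrank_eq (sup_le inf_le_right (by simpa using hyp)) ?_).symm
      rw [finrank_sup_span_singleton_of_notMem (notMem_inf_left hyr), hlt, p.2]
    refine ⟨⟨r.1 ⊓ p.1 ⊔ K ∙ (x + y), ?_⟩, ?_, ?_⟩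
    · rw [finrank_sup_span_singleton_of_notMem (notMem_inf_left hxy), hlt]
    · intro h
      rw [Subtype.ext_iff] at h
      refine hxy ?_
      rw [← h]
      exact Submodule.mem_sup_right (Submodule.mem_span_singleton_self _)
    · intro c hc
      by_contra! hcon
      have h₁ : ¬ Disjoint c.1 p.1 := fun h => hcon.1 (isCompl_of_disjoint_of_finrank hV c.2 p.2 h)
      have h₂ : ¬ Disjoint c.1 (r.1 ⊓ p.1 ⊔ K ∙ (x + y)) := fun h =>
        hcon.2 (isCompl_of_disjoint_of_finrank hV c.2
          (by rw [finrank_sup_span_singleton_of_notMem (notMem_inf_left hxy), hlt]) h)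
      have hcr := Submodule.disjoint_def.1 hc.disjoint
      have key : ∀ w : V, w ∉ r.1 → ¬ Disjoint c.1 (r.1 ⊓ p.1 ⊔ K ∙ w) →
          ∃ a ∈ r.1 ⊓ p.1, a + w ∈ c.1 := by
        intro w hw h
        simp only [Submodule.disjoint_def, not_forall] at h
        obtain ⟨z, hzc, hz, hz0⟩ := h
        obtain ⟨a, ha, v, hv, rfl⟩ := Submodule.mem_sup.1 hz
        obtain ⟨b, rfl⟩ := Submodule.mem_span_singleton.1 hv
        have hb : b ≠ 0 := by
          rintro rfl
          exact hz0 (hcr _ hzc (by simpa using ha.1))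
        refine ⟨b⁻¹ • a, Submodule.smul_mem _ _ ha, ?_⟩
        have := c.1.smul_mem b⁻¹ hzc
        rwa [smul_add, smul_smul, inv_mul_cancel₀ hb, one_smul] at this
      rw [hpy] at h₁
      obtain ⟨a, ha, hac⟩ := key y hyr h₁
      obtain ⟨b, hb, hbc⟩ := key (x + y) hxy h₂
      have heq : b + (x + y) - (a + y) = b + x - a := by abel
      have h0 := hcr _ (c.1.sub_mem hbc hac)
        (heq ▸ r.1.sub_mem (r.1.add_mem hb.1 hxr) ha.1)
      rw [heq] at h0
      have : x = a - b := by
        rw [← sub_eq_zero, ← h0]; abel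
      exact hxp (this ▸ p.1.sub_mem ha.2 hb.2)

theorem Grass.exists_adj_of_mem_notMem (hV : finrank K V = n + n) (p q : Grass K V n)
    (hpq : p ≠ q) : ∃ s, DistAdj Grass.Compl p s ∧
      finrank K (p.1 ⊓ q.1 : Submodule K V) < finrank K (s.1 ⊓ q.1 : Submodule K V) := by
  have hne : p.1 ≠ q.1 := fun h => hpq (Subtype.ext h)
  obtain ⟨x, hxp, hxq⟩ := exists_mem_notMem_of_finrank_eq p.2 q.2 hne
  obtain ⟨y, hyq, hyp⟩ := exists_mem_notMem_of_finrank_eq q.2 p.2 hne.symm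
  obtain ⟨H, hHp, hH, -, hHn⟩ := exists_hyperplane_notMem (inf_le_left : p.1 ⊓ q.1 ≤ p.1) hxp
    (fun h => hxq h.2)
  have hyH : y ∉ H := fun h => hyp (hHp h)
  have hp := p.2
  have hymem : y ∈ H ⊔ K ∙ y := Submodule.mem_sup_right (Submodule.mem_span_singleton_self y)
  refine ⟨⟨H ⊔ K ∙ y, ?_⟩, (Grass.distAdj_iff hV _ _).2 ⟨fun h => ?_, ?_⟩, ?_⟩
  · rw [finrank_sup_span_singleton_of_notMem hyH]; omega
  · rw [Subtype.ext_iff] at h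
    exact hyp (h ▸ hymem)
  · have := Submodule.finrank_mono (le_inf hHp le_sup_left : H ≤ p.1 ⊓ (H ⊔ K ∙ y))
    dsimp only
    omega
  · refine Submodule.finrank_lt_finrank_of_lt (lt_of_le_of_ne
      (le_inf (hH.trans le_sup_left) inf_le_right) fun h => ?_)
    exact hyp (h.symm ▸ (⟨hymem, hyq⟩ : y ∈ (H ⊔ K ∙ y) ⊓ q.1) : y ∈ p.1 ⊓ q.1).1

theorem Grass.connected (hV : finrank K V = n + n) (p q : Grass K V n) :
    Relation.ReflTransGen (DistAdj Grass.Compl) p q := by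
  induction hk : n - finrank K (p.1 ⊓ q.1 : Submodule K V) using Nat.strong_induction_on
    generalizing p with
  | _ k ih =>
    by_cases hpq : p = q
    · rw [hpq]
    · obtain ⟨s, hs, hlt⟩ := Grass.exists_adj_of_mem_notMem hV p q hpq
      have := Submodule.finrank_mono (inf_le_right : s.1 ⊓ q.1 ≤ q.1)
      have := q.2
      exact (ih _ (by omega) s rfl).head hs

theorem Grass.isRigidDistant [Nonempty (Grass K V n)] (hV : finrank K V = n + n) (hn : 1 ≤ n) :
    IsRigidDistant (Grass.Compl : Grass K V n → Grass K V n → Prop) := by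
  have hcompl : ∀ p : Grass K V n, ∃ c : Grass K V n, c.Compl p := fun p => by
    obtain ⟨c, hc, -, h⟩ := exists_isCompl_of_disjoint hV p.2 disjoint_bot_left
    exact ⟨⟨c, hc⟩, h⟩
  refine ⟨‹_›, hcompl, Grass.eq_of_subset hV, ⟨?_, fun p h => h.1 rfl, ?_, ?_, Grass.connected hV⟩⟩
  · intro p q
    rw [Grass.distAdj_iff hV, Grass.distAdj_iff hV, inf_comm]
    exact fun h => ⟨h.1.symm, h.2⟩
  · intro p
    obtain ⟨c, hc⟩ := hcompl p
    have hne : p ≠ c := by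
      rintro rfl
      have h := hc.disjoint
      rw [disjoint_self] at h
      have := p.2
      rw [h, finrank_bot] at this
      omega
    obtain ⟨s, hs, -⟩ := Grass.exists_adj_of_mem_notMem hV p c hne
    exact ⟨s, hs⟩
  · intro p q q' h h'
    rw [Grass.distAdj_iff hV] at h h'
    have hne' : q'.1 ≠ p.1 := fun hh => h'.1 (Subtype.ext hh)
    have hne : q.1 ≠ p.1 := fun hh => h.1 (Subtype.ext hh)
    obtain ⟨y, hyq, hyp⟩ := exists_mem_notMem_of_finrank_eq q'.2 p.2 hne'
    have hlt : finrank K (p.1 ⊓ q.1 : Submodule K V) + 1 = n := by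
      have hlt : p.1 ⊓ q.1 < p.1 := lt_of_le_of_ne inf_le_left fun hh =>
        hne (Submodule.eq_of_le_of_finrank_eq (inf_eq_left.1 hh) (p.2.trans q.2.symm)).symm
      have := Submodule.finrank_lt_finrank_of_lt hlt
      have := p.2
      have := h.2
      omega
    have hymem : y ∈ p.1 ⊓ q.1 ⊔ K ∙ y :=
      Submodule.mem_sup_right (Submodule.mem_span_singleton_self y)
    have hs : finrank K (p.1 ⊓ q.1 ⊔ K ∙ y : Submodule K V) = n := by
      rw [finrank_sup_span_singleton_of_notMem (notMem_inf_left hyp), hlt]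
    have adj : ∀ (a b : Grass K V n) (D : Submodule K V), D ≤ a.1 → D ≤ b.1 →
        n ≤ finrank K D + 1 → a ≠ b → DistAdj Grass.Compl a b := by
      intro a b D ha hb hD hab
      have := Submodule.finrank_mono (le_inf ha hb)
      exact (Grass.distAdj_iff hV _ _).2 ⟨hab.symm, by omega⟩
    refine ⟨⟨_, hs⟩, adj _ _ (p.1 ⊓ q.1) inf_le_left le_sup_left hlt.ge ?_, ?_, ?_⟩
    · intro hh
      rw [Subtype.ext_iff] at hh
      exact hyp (hh ▸ hymem)
    · exact or_iff_not_imp_left.2 (adj _ _ (p.1 ⊓ q.1) inf_le_right le_sup_left hlt.ge)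
    · refine or_iff_not_imp_left.2 (adj _ _ ((p.1 ⊓ q.1) ⊓ (p.1 ⊓ q'.1) ⊔ K ∙ y)
        (sup_le_sup_right inf_le_left _) (sup_le (inf_le_right.trans inf_le_right)
          (by simpa using hyq)) ?_)
      rw [finrank_sup_span_singleton_of_notMem (notMem_inf_left (notMem_inf_left hyp))]
      have h₁ := Submodule.finrank_sup_add_finrank_inf_eq (p.1 ⊓ q.1) (p.1 ⊓ q'.1)
      have h₂ := Submodule.finrank_mono
        (sup_le inf_le_left inf_le_left : (p.1 ⊓ q.1) ⊔ (p.1 ⊓ q'.1) ≤ p.1)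
      have := p.2
      have := h'.2
      omega

end Grassmannian

/-! ## Projective lines -/

section ProjectiveLine

variable {A B : Type*} [Ring A] [Ring B]

/-- The semilinear map `A² → B²` induced by a ring homomorphism. -/
def pairMap (f : A →+* B) : (A × A) →ₛₗ[f] (B × B) where
  toFun x := (f x.1, f x.2)
  map_add' x y := by simp
  map_smul' r x := by simp

/-- The map on submodules of `A²` induced by a surjective ring homomorphism. -/
def mapPoint (f : A →+* B) [RingHomSurjective f] (p : Submodule A (A × A)) :
    Submodule B (B × B) :=
  Submodule.map (pairMap f) p

theorem mapPoint_span (f : A →+* B) [RingHomSurjective f] (a b : A) :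
    mapPoint f (Submodule.span A {(a, b)}) = Submodule.span B {(f a, f b)} := by
  simp [mapPoint, Submodule.map_span, pairMap]

theorem Distant.mapPoint (f : A →+* B) [RingHomSurjective f] {p q : Submodule A (A × A)}
    (h : Distant p q) : Distant (mapPoint f p) (mapPoint f q) := by
  obtain ⟨g, rfl, rfl⟩ := h
  exact ⟨Units.map f.mapMatrix.toMonoidHom g, by simp [mapPoint_span], by simp [mapPoint_span]⟩

theorem IsPoint.exists_distant {p : Submodule A (A × A)} (h : IsPoint A p) :
    ∃ q, Distant p q := by
  obtain ⟨g, rfl⟩ := h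
  exact ⟨_, g, rfl, rfl⟩

theorem Distant.isPoint_left {p q : Submodule A (A × A)} (h : Distant p q) : IsPoint A p := by
  obtain ⟨g, rfl, rfl⟩ := h
  exact ⟨g, rfl⟩

theorem Distant.symm {p q : Submodule A (A × A)} (h : Distant p q) : Distant q p := by
  obtain ⟨g, rfl, rfl⟩ := h
  have hs : (!![0, 1; 1, 0] : Matrix (Fin 2) (Fin 2) A) * !![0, 1; 1, 0] = 1 := by
    simp [Matrix.one_fin_two]
  refine ⟨⟨_, _, hs, hs⟩ * g, ?_, ?_⟩ <;> simp [Matrix.mul_apply, Fin.sum_univ_two]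

theorem Distant.isPoint_right {p q : Submodule A (A × A)} (h : Distant p q) : IsPoint A q :=
  h.symm.isPoint_left

theorem IsPoint.mapPoint (f : A →+* B) [RingHomSurjective f] {p : Submodule A (A × A)}
    (h : IsPoint A p) : IsPoint B (mapPoint f p) := by
  obtain ⟨q, hq⟩ := h.exists_distant
  exact (hq.mapPoint f).isPoint_left

theorem exists_row_mul_eq_one (g : (Matrix (Fin 2) (Fin 2) A)ˣ) (i : Fin 2) :
    ∃ x y, g.val i 0 * x + g.val i 1 * y = 1 := by
  refine ⟨g⁻¹.val 0 i, g⁻¹.val 1 i, ?_⟩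
  have := congrFun (congrFun g.mul_inv i) i
  simpa [Matrix.mul_apply, Fin.sum_univ_two] using this

/-- Unimodular generators of the same submodule differ by a unit. -/
theorem exists_unit_smul_of_span_eq {a b c d x y z w : A} (hab : a * x + b * y = 1)
    (hcd : c * z + d * w = 1)
    (h : Submodule.span A {(a, b)} = Submodule.span A {(c, d)}) :
    ∃ u : Aˣ, a = u * c ∧ b = u * d := by
  obtain ⟨u, hu⟩ := Submodule.mem_span_singleton.1
    (h ▸ Submodule.mem_span_singleton_self (a, b) : (a, b) ∈ Submodule.span A {(c, d)})
  obtain ⟨v, hv⟩ := Submodule.mem_span_singleton.1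
    (h.symm ▸ Submodule.mem_span_singleton_self (c, d) : (c, d) ∈ Submodule.span A {(a, b)})
  simp only [Prod.smul_mk, smul_eq_mul, Prod.mk.injEq] at hu hv
  have huv : u * v = 1 := by
    calc u * v = u * v * (a * x + b * y) := by rw [hab, mul_one]
      _ = u * (v * a) * x + u * (v * b) * y := by noncomm_ring
      _ = 1 := by rw [hv.1, hv.2, hu.1, hu.2, hab]
  have hvu : v * u = 1 := by
    calc v * u = v * u * (c * z + d * w) := by rw [hcd, mul_one]
      _ = v * (u * c) * z + v * (u * d) * w := by noncomm_ring
      _ = 1 := by rw [hu.1, hu.2, hv.1, hv.2, hcd]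
  exact ⟨⟨u, v, huv, hvu⟩, hu.1.symm, hu.2.symm⟩

/-- Unimodular generators of distant points form an invertible matrix. -/
theorem Distant.isUnit_of_eq_span {a b c d x y z w : A} (hab : a * x + b * y = 1)
    (hcd : c * z + d * w = 1)
    (h : Distant (Submodule.span A {(a, b)}) (Submodule.span A {(c, d)})) :
    IsUnit !![a, b; c, d] := by
  obtain ⟨k, h₀, h₁⟩ := h
  obtain ⟨x', y', hk₀⟩ := exists_row_mul_eq_one k 0
  obtain ⟨z', w', hk₁⟩ := exists_row_mul_eq_one k 1
  obtain ⟨u, hu₁, hu₂⟩ := exists_unit_smul_of_span_eq hab hk₀ h₀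
  obtain ⟨v, hv₁, hv₂⟩ := exists_unit_smul_of_span_eq hcd hk₁ h₁
  have hd : IsUnit !![(u : A), 0; 0, (v : A)] :=
    ⟨⟨_, !![((u⁻¹ : Aˣ) : A), 0; 0, ((v⁻¹ : Aˣ) : A)], by simp [Matrix.one_fin_two],
      by simp [Matrix.one_fin_two]⟩, rfl⟩
  have : !![a, b; c, d] = !![(u : A), 0; 0, (v : A)] * k.val := by
    ext i j
    fin_cases i <;> fin_cases j <;> 
      simp [Matrix.mul_apply, Fin.sum_univ_two, hu₁, hu₂, hv₁, hv₂]
  rw [this]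
  exact hd.mul k.isUnit

/-! ### Products of rings -/

section Pi

variable {I : Type*} {R : I → Type*} [∀ i, Ring (R i)]

theorem component_span (a b : Π i, R i) (j : I) :
    component (Submodule.span (Π i, R i) {(a, b)}) j = Submodule.span (R j) {(a j, b j)} :=
  mapPoint_span (Pi.evalRingHom R j) a b

/-- A family of invertible matrices as an invertible matrix over the product ring. -/
theorem exists_matrix_pi (g : ∀ i, (Matrix (Fin 2) (Fin 2) (R i))ˣ) :
    ∃ h : (Matrix (Fin 2) (Fin 2) (Π i, R i))ˣ, ∀ a b i, h.val a b i = (g i).val a b := by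
  refine ⟨⟨Matrix.of fun a b i => (g i).val a b, Matrix.of fun a b i => (g i)⁻¹.val a b, ?_, ?_⟩,
    fun _ _ _ => rfl⟩
  · ext a b i
    have := congrFun (congrFun (g i).mul_inv a) b
    simp only [Matrix.mul_apply, Fin.sum_univ_two] at this
    simp only [Matrix.mul_apply, Fin.sum_univ_two, Matrix.of_apply, Pi.add_apply, Pi.mul_apply,
      this, Matrix.one_apply]
    split_ifs <;> rfl
  · ext a b i
    have := congrFun (congrFun (g i).inv_mul a) b
    simp only [Matrix.mul_apply, Fin.sum_univ_two] at this
    simp only [Matrix.mul_apply, Fin.sum_univ_two, Matrix.of_apply, Pi.add_apply, Pi.mul_apply,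
      this, Matrix.one_apply]
    split_ifs <;> rfl

theorem eq_of_component_eq {p q : Submodule (Π i, R i) ((Π i, R i) × (Π i, R i))}
    (hp : IsPoint _ p) (hq : IsPoint _ q) (h : ∀ j, component p j = component q j) : p = q := by
  have key : ∀ a b c d : Π i, R i,
      (∀ j, Submodule.span (R j) {(a j, b j)} ≤ Submodule.span (R j) {(c j, d j)}) →
      Submodule.span (Π i, R i) {(a, b)} ≤ Submodule.span (Π i, R i) {(c, d)} := by
    intro a b c d h
    rw [Submodule.span_singleton_le_iff_mem, Submodule.mem_span_singleton]
    choose r hr using fun j => Submodule.mem_span_singleton.1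
      ((Submodule.span_singleton_le_iff_mem _ _).1 (h j))
    exact ⟨r, Prod.ext (funext fun j => congrArg Prod.fst (hr j))
      (funext fun j => congrArg Prod.snd (hr j))⟩
  obtain ⟨g, rfl⟩ := hp
  obtain ⟨k, rfl⟩ := hq
  simp only [component_span] at h
  exact le_antisymm (key _ _ _ _ fun j => (h j).le) (key _ _ _ _ fun j => (h j).ge)

theorem distant_iff_component {p q : Submodule (Π i, R i) ((Π i, R i) × (Π i, R i))}
    (hp : IsPoint _ p) (hq : IsPoint _ q) :
    Distant p q ↔ ∀ j, Distant (component p j) (component q j) := by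
  constructor
  · intro h j
    exact h.mapPoint (Pi.evalRingHom R j)
  · intro h
    choose g hg₀ hg₁ using h
    obtain ⟨k, hk⟩ := exists_matrix_pi g
    have h : Distant (Submodule.span (Π i, R i) {(k.val 0 0, k.val 0 1)})
      (Submodule.span (Π i, R i) {(k.val 1 0, k.val 1 1)}) := ⟨k, rfl, rfl⟩
    convert h
    · exact eq_of_component_eq hp h.isPoint_left fun j => by
        rw [hg₀, component_span, hk, hk]
    · exact eq_of_component_eq hq h.isPoint_right fun j => by
        rw [hg₁, component_span, hk, hk]

variable (R) in
/-- The identification of the projective line over a product with the product of the projective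
lines. -/
noncomputable def pointPiEquiv : PL (Π i, R i) ≃ ∀ i, PL (R i) :=
  Equiv.ofBijective
    (fun p i => ⟨component p.1 i, p.2.mapPoint (Pi.evalRingHom R i)⟩) <| by
    refine ⟨fun p q h => Subtype.ext (eq_of_component_eq p.2 q.2 fun j =>
      congrArg Subtype.val (congrFun h j)), fun P => ?_⟩
    choose g hg using fun i => (P i).2
    obtain ⟨k, hk⟩ := exists_matrix_pi g
    refine ⟨⟨_, k, rfl⟩, funext fun j => Subtype.ext ?_⟩
    dsimp only
    rw [component_span, hk, hk, hg]

theorem pointPiEquiv_apply (p : PL (Π i, R i)) (i : I) :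
    (pointPiEquiv R p i).1 = component p.1 i := rfl

theorem distant_iff_pointPiEquiv (p q : PL (Π i, R i)) :
    Distant p.1 q.1 ↔ ∀ i, Distant (pointPiEquiv R p i).1 (pointPiEquiv R q i).1 :=
  distant_iff_component p.2 q.2

end Pi

/-! ### Reduction modulo the radical -/

theorem jacobsonRadical_eq : JacobsonRadical A = ((⊥ : Ideal A).jacobson : Set A) := by
  ext a
  simp [JacobsonRadical, Ideal.jacobson]

theorem isUnit_of_isUnit_mapMatrix (f : A →+* B) (hf : Function.Surjective f)
    (hker : ∀ a : A, f a = 0 → a ∈ JacobsonRadical A) (M : Matrix (Fin 2) (Fin 2) A)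
    (hM : IsUnit (f.mapMatrix M)) : IsUnit M := by
  have hleft : ∀ (M : Matrix (Fin 2) (Fin 2) A) (N' : Matrix (Fin 2) (Fin 2) B),
      N' * f.mapMatrix M = 1 → ∃ L, L * M = 1 ∧ f.mapMatrix L = N' := by
    intro M N' h
    obtain ⟨N, rfl⟩ : ∃ N, f.mapMatrix N = N' := by
      choose s hs using hf
      exact ⟨N'.map s, by ext; simp [hs]⟩
    have hJ : N * M - 1 ∈ (⊥ : Ideal (Matrix (Fin 2) (Fin 2) A)).jacobson := by
      rw [← Ideal.matrix_bot]
      refine Ideal.matrix_jacobson_le _ fun i j => ?_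
      have h0 : f.mapMatrix (N * M - 1) = 0 := by
        rw [map_sub, map_mul, map_one, h, sub_self]
      have := hker ((N * M - 1) i j) (congrFun (congrFun h0 i) j)
      rwa [jacobsonRadical_eq] at this
    obtain ⟨z, hz⟩ := Ideal.mem_jacobson_iff.1 hJ 1
    have hz1 : z * (N * M) = 1 := by
      rw [Ideal.mem_bot] at hz
      rw [← sub_eq_zero, ← hz]
      noncomm_ring
    refine ⟨z * N, by rw [mul_assoc, hz1], ?_⟩
    have := congrArg f.mapMatrix hz1
    rw [map_mul, map_mul, h, mul_one, map_one] at this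
    rw [map_mul, this, one_mul]
  obtain ⟨u, hu⟩ := hM
  obtain ⟨L, hL, hLu⟩ := hleft M ((u⁻¹ : (Matrix (Fin 2) (Fin 2) B)ˣ) : Matrix (Fin 2) (Fin 2) B)
    (by rw [← hu, Units.inv_mul])
  obtain ⟨L', hL', -⟩ := hleft L u (by rw [hLu, Units.mul_inv])
  have : L' = M := by rw [← mul_one L', ← hL, ← mul_assoc, hL', one_mul]
  exact ⟨⟨M, L, this ▸ hL', hL⟩, rfl⟩

variable (f : A →+* B) [RingHomSurjective f]

theorem distant_mapPoint_iff (hker : ∀ a : A, f a = 0 → a ∈ JacobsonRadical A)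
    {p q : Submodule A (A × A)} (hp : IsPoint A p) (hq : IsPoint A q) :
    Distant p q ↔ Distant (mapPoint f p) (mapPoint f q) := by
  refine ⟨fun h => h.mapPoint f, fun h => ?_⟩
  obtain ⟨g, rfl⟩ := hp
  obtain ⟨k, rfl⟩ := hq
  rw [mapPoint_span, mapPoint_span] at h
  obtain ⟨x, y, hg⟩ := exists_row_mul_eq_one g 0
  obtain ⟨z, w, hk⟩ := exists_row_mul_eq_one k 0
  replace hg := congrArg f hg
  replace hk := congrArg f hk
  simp only [map_add, map_mul, map_one] at hg hk
  have hu := h.isUnit_of_eq_span hg hk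
  have hM : f.mapMatrix !![g.val 0 0, g.val 0 1; k.val 0 0, k.val 0 1] =
      !![f (g.val 0 0), f (g.val 0 1); f (k.val 0 0), f (k.val 0 1)] := by
    ext i j
    fin_cases i <;> fin_cases j <;> rfl
  rw [← hM] at hu
  obtain ⟨v, hv⟩ := isUnit_of_isUnit_mapMatrix f RingHomSurjective.is_surjective hker _ hu
  exact ⟨v, by simp [hv], by simp [hv]⟩

theorem exists_mapPoint_eq (hker : ∀ a : A, f a = 0 → a ∈ JacobsonRadical A)
    {P : Submodule B (B × B)} (hP : IsPoint B P) : ∃ p, IsPoint A p ∧ mapPoint f p = P := by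
  obtain ⟨g, rfl⟩ := hP
  have hf : Function.Surjective f := RingHomSurjective.is_surjective
  choose s hs using hf
  have hM : f.mapMatrix (g.val.map s) = g.val := by ext; simp [hs]
  obtain ⟨v, hv⟩ := isUnit_of_isUnit_mapMatrix f RingHomSurjective.is_surjective hker
    (g.val.map s) (by rw [hM]; exact g.isUnit)
  exact ⟨_, ⟨v, rfl⟩, by simp [mapPoint_span, hv, hs]⟩

/-- The map between projective lines induced by a surjective ring homomorphism. -/
def pointMap (p : PL A) : PL B := ⟨mapPoint f p.1, p.2.mapPoint f⟩

theorem distant_pointMap_iff (hker : ∀ a : A, f a = 0 → a ∈ JacobsonRadical A) (p q : PL A) :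
    Distant p.1 q.1 ↔ Distant (pointMap f p).1 (pointMap f q).1 :=
  distant_mapPoint_iff f hker p.2 q.2

theorem pointMap_surjective (hker : ∀ a : A, f a = 0 → a ∈ JacobsonRadical A) :
    Function.Surjective (pointMap f) := by
  intro P
  obtain ⟨p, hp, h⟩ := exists_mapPoint_eq f hker P.2
  exact ⟨⟨p, hp⟩, Subtype.ext h⟩

theorem parallel_iff (p q : PL A) :
    Parallel p.1 q.1 ↔ ∀ c : PL A, Distant c.1 p.1 → Distant c.1 q.1 :=
  ⟨fun h _ hc => h hc, fun h _ hc => h ⟨_, hc.isPoint_left⟩ hc⟩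

end ProjectiveLine

/-! ### Endomorphism rings -/

section Endomorphism

open Module

variable {K U : Type*} [DivisionRing K] [AddCommGroup U] [Module K U]

/-- The submodule of all pairs of endomorphisms with values in a given subspace of `U × U`. -/
def pointOfSubspace (W : Submodule K (U × U)) : Submodule (EndOp K U) (EndOp K U × EndOp K U) where
  carrier := {x | ∀ u, (x.1.unop u, x.2.unop u) ∈ W}
  add_mem' hx hy u := W.add_mem (hx u) (hy u)
  zero_mem' _ := W.zero_mem
  smul_mem' r _ hx u := hx (r.unop u)

/-- A pair of endomorphisms of `U` as a linear map `U → U × U`. -/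
def pairToProd (a b : EndOp K U) : U →ₗ[K] U × U := a.unop.prod b.unop

theorem pointOfSubspace_range (a b : EndOp K U) :
    pointOfSubspace (LinearMap.range (pairToProd a b)) =
      Submodule.span (EndOp K U) {(a, b)} := by
  apply le_antisymm
  · rintro ⟨c, d⟩ h
    rw [Submodule.mem_span_singleton]
    obtain ⟨r, hr⟩ := Module.projective_lifting_property (pairToProd a b).rangeRestrict
      ((pairToProd c d).codRestrict (LinearMap.range (pairToProd a b)) h)
      (pairToProd a b).surjective_rangeRestrict
    have hr' : ∀ u, pairToProd a b (r u) = pairToProd c d u := fun u =>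
      congrArg Subtype.val (LinearMap.congr_fun hr u)
    refine ⟨op r, Prod.ext (unop_injective (LinearMap.ext fun u => ?_))
      (unop_injective (LinearMap.ext fun u => ?_))⟩
    · exact congrArg Prod.fst (hr' u)
    · exact congrArg Prod.snd (hr' u)
  · rw [Submodule.span_singleton_le_iff_mem]
    exact fun u => ⟨u, rfl⟩

theorem pointOfSubspace_injective [Nontrivial U] :
    Function.Injective (pointOfSubspace : Submodule K (U × U) → _) := by
  have key : ∀ W W' : Submodule K (U × U), pointOfSubspace W ≤ pointOfSubspace W' → W ≤ W' := by
    intro W W' h w hw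
    obtain ⟨u, hu⟩ := exists_ne (0 : U)
    obtain ⟨f, hf⟩ := Module.Projective.exists_dual_ne_zero K hu
    let L : U →ₗ[K] U × U := (LinearMap.toSpanSingleton K (U × U) ((f u)⁻¹ • w)).comp f
    have hL : (op (LinearMap.fst K U U ∘ₗ L), op (LinearMap.snd K U U ∘ₗ L)) ∈
        pointOfSubspace W := fun v => W.smul_mem (f v) (W.smul_mem (f u)⁻¹ hw)
    have : L u = w := by simp [L, smul_smul, mul_inv_cancel₀ hf]
    exact this ▸ h hL u
  exact fun W W' h => le_antisymm (key _ _ h.le) (key _ _ h.ge)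

/-- The matrix over the endomorphism ring that represents an endomorphism of `U × U`. -/
def prodEndMatrix (T : Module.End K (U × U)) : Matrix (Fin 2) (Fin 2) (EndOp K U) :=
  !![op (LinearMap.fst K U U ∘ₗ T ∘ₗ LinearMap.inl K U U),
     op (LinearMap.snd K U U ∘ₗ T ∘ₗ LinearMap.inl K U U);
     op (LinearMap.fst K U U ∘ₗ T ∘ₗ LinearMap.inr K U U),
     op (LinearMap.snd K U U ∘ₗ T ∘ₗ LinearMap.inr K U U)]

theorem prodEndMatrix_mul (T S : Module.End K (U × U)) :
    prodEndMatrix T * prodEndMatrix S = prodEndMatrix (S ∘ₗ T) := by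
  have key : ∀ x y : U, S (x, y) = S (x, 0) + S (0, y) := fun x y => by simp [← map_add]
  ext i j
  refine unop_injective (LinearMap.ext fun u => ?_)
  fin_cases i <;> fin_cases j <;>
    simp [prodEndMatrix, Matrix.mul_apply, Fin.sum_univ_two, key (T _).1 (T _).2]

theorem prodEndMatrix_id : prodEndMatrix (LinearMap.id : Module.End K (U × U)) = 1 := by
  ext i j
  refine unop_injective (LinearMap.ext fun u => ?_)
  fin_cases i <;> fin_cases j <;> simp [prodEndMatrix]

/-- The endomorphism of `U × U` represented by a matrix over the endomorphism ring. -/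
def matrixProdEnd (M : Matrix (Fin 2) (Fin 2) (EndOp K U)) : Module.End K (U × U) :=
  (pairToProd (M 0 0) (M 0 1)).coprod (pairToProd (M 1 0) (M 1 1))

theorem matrixProdEnd_mul (M N : Matrix (Fin 2) (Fin 2) (EndOp K U)) :
    matrixProdEnd (M * N) = matrixProdEnd N ∘ₗ matrixProdEnd M := by
  ext u <;> simp [matrixProdEnd, pairToProd, Matrix.mul_apply, Fin.sum_univ_two]

theorem matrixProdEnd_one :
    matrixProdEnd (1 : Matrix (Fin 2) (Fin 2) (EndOp K U)) = LinearMap.id := by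
  ext u <;> simp [matrixProdEnd, pairToProd]

theorem isCompl_range_of_unit (g : (Matrix (Fin 2) (Fin 2) (EndOp K U))ˣ) :
    IsCompl (LinearMap.range (pairToProd (g.val 0 0) (g.val 0 1)))
      (LinearMap.range (pairToProd (g.val 1 0) (g.val 1 1))) ∧
    ∀ i, finrank K (LinearMap.range (pairToProd (g.val i 0) (g.val i 1))) = finrank K U := by
  let E : (U × U) ≃ₗ[K] (U × U) := LinearEquiv.ofLinearMap (matrixProdEnd g.val)
    (matrixProdEnd g⁻¹.val) (by rw [← matrixProdEnd_mul, Units.inv_mul, matrixProdEnd_one])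
    (by rw [← matrixProdEnd_mul, Units.mul_inv, matrixProdEnd_one])
  have h₀ : pairToProd (g.val 0 0) (g.val 0 1) = E.toLinearMap ∘ₗ LinearMap.inl K U U := by
    ext u <;> simp [E, matrixProdEnd]
  have h₁ : pairToProd (g.val 1 0) (g.val 1 1) = E.toLinearMap ∘ₗ LinearMap.inr K U U := by
    ext u <;> simp [E, matrixProdEnd]
  refine ⟨?_, fun i => ?_⟩
  · rw [h₀, h₁, LinearMap.range_comp, LinearMap.range_comp]
    exact (Submodule.orderIsoMapComap E).isCompl LinearMap.isCompl_range_inl_inr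
  · apply LinearMap.finrank_range_of_inj
    fin_cases i
    · simpa [h₀] using E.injective.comp (LinearMap.inl_injective (R := K) (M := U) (M₂ := U))
    · simpa [h₁] using E.injective.comp (LinearMap.inr_injective (R := K) (M := U) (M₂ := U))

variable [FiniteDimensional K U]

theorem distant_of_isCompl {W W' : Submodule K (U × U)} (hW : finrank K W = finrank K U)
    (hW' : finrank K W' = finrank K U) (h : IsCompl W W') :
    Distant (pointOfSubspace W) (pointOfSubspace W') := by
  let e₀ : U ≃ₗ[K] W := LinearEquiv.ofFinrankEq _ _ hW.symm
  let e₁ : U ≃ₗ[K] W' := LinearEquiv.ofFinrankEq _ _ hW'.symm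
  let E : (U × U) ≃ₗ[K] (U × U) := (e₀.prodCongr e₁).trans (Submodule.prodEquivOfIsCompl W W' h)
  let g : (Matrix (Fin 2) (Fin 2) (EndOp K U))ˣ :=
    ⟨prodEndMatrix E.toLinearMap, prodEndMatrix E.symm.toLinearMap,
      by rw [prodEndMatrix_mul, ← prodEndMatrix_id]; congr 1; ext <;> simp,
      by rw [prodEndMatrix_mul, ← prodEndMatrix_id]; congr 1; ext <;> simp⟩
  have h₀ : W = LinearMap.range (pairToProd (g.val 0 0) (g.val 0 1)) := by
    have : pairToProd (g.val 0 0) (g.val 0 1) = W.subtype ∘ₗ e₀.toLinearMap := by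
      ext u <;> simp [g, E, prodEndMatrix, pairToProd]
    rw [this, LinearMap.range_comp, LinearEquiv.range, Submodule.map_top, Submodule.range_subtype]
  have h₁ : W' = LinearMap.range (pairToProd (g.val 1 0) (g.val 1 1)) := by
    have : pairToProd (g.val 1 0) (g.val 1 1) = W'.subtype ∘ₗ e₁.toLinearMap := by
      ext u <;> simp [g, E, prodEndMatrix, pairToProd]
    rw [this, LinearMap.range_comp, LinearEquiv.range, Submodule.map_top, Submodule.range_subtype]
  exact ⟨g, by rw [← pointOfSubspace_range, ← h₀], by rw [← pointOfSubspace_range, ← h₁]⟩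

variable (K U) in
theorem finrank_prod_self : finrank K (U × U) = finrank K U + finrank K U := Module.finrank_prod

theorem distant_pointOfSubspace_iff [Nontrivial U] (W W' : Grass K (U × U) (finrank K U)) :
    W.Compl W' ↔ Distant (pointOfSubspace W.1) (pointOfSubspace W'.1) := by
  refine ⟨distant_of_isCompl W.2 W'.2, ?_⟩
  rintro ⟨g, h₀, h₁⟩
  rw [← pointOfSubspace_range] at h₀ h₁
  rw [Grass.Compl, pointOfSubspace_injective h₀, pointOfSubspace_injective h₁]
  exact (isCompl_range_of_unit g).1

variable (K U) in
/-- Points of the projective line over the endomorphism ring of `U` correspond to subspaces of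
`U × U` of dimension `dim U`. -/
noncomputable def grassEquiv [Nontrivial U] : Grass K (U × U) (finrank K U) ≃ PL (EndOp K U) :=
  Equiv.ofBijective
    (fun W => ⟨pointOfSubspace W.1, by
      obtain ⟨c, hc, -, h⟩ := exists_isCompl_of_disjoint (finrank_prod_self K U) W.2 disjoint_bot_left
      exact (distant_of_isCompl W.2 hc h.symm).isPoint_left⟩) <| by
    refine ⟨fun W W' h => Subtype.ext (pointOfSubspace_injective (congrArg Subtype.val h)), ?_⟩
    rintro ⟨_, g, rfl⟩
    exact ⟨⟨_, (isCompl_range_of_unit g).2 0⟩, Subtype.ext (pointOfSubspace_range _ _)⟩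

variable (K U) in
theorem isRigidDistant_endOp (hU : 1 ≤ finrank K U) :
    IsRigidDistant fun p q : PL (EndOp K U) => Distant p.1 q.1 := by
  have : Nontrivial U := Module.nontrivial_of_finrank_pos (R := K) hU
  have : Nonempty (Grass K (U × U) (finrank K U)) :=
    ⟨_, LinearMap.finrank_range_of_inj (LinearMap.inl_injective (R := K) (M := U) (M₂ := U))⟩
  exact (Grass.isRigidDistant (finrank_prod_self K U) hU).of_equiv (grassEquiv K U)
    distant_pointOfSubspace_iff

end Endomorphism

/-! ## Distant-isomorphisms -/

section Induced

/-- A distant-preserving bijection descends along surjections that reflect the distant relation. -/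
theorem exists_induced_equiv {X Y Z W : Type*} {dX : X → X → Prop} {dY : Y → Y → Prop}
    {dZ : Z → Z → Prop} {dW : W → W → Prop} {β : X → Z} {γ : Y → W}
    (hβ : Function.Surjective β) (hγ : Function.Surjective γ)
    (hdβ : ∀ p q, dX p q ↔ dZ (β p) (β q)) (hdγ : ∀ p q, dY p q ↔ dW (γ p) (γ q))
    (hZ : ∀ p q, (∀ c, dZ c p → dZ c q) → p = q) (hW : ∀ p q, (∀ c, dW c p → dW c q) → p = q)
    {φ : X → Y} (hφ : Function.Bijective φ) (hdφ : ∀ p q, dX p q ↔ dY (φ p) (φ q)) :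
    ∃ Ψ : Z ≃ W, (∀ p, Ψ (β p) = γ (φ p)) ∧ ∀ P Q, dZ P Q ↔ dW (Ψ P) (Ψ Q) := by
  have hfib : ∀ p q, β p = β q ↔ γ (φ p) = γ (φ q) := by
    intro p q
    constructor
    · intro h
      refine hW _ _ fun c hc => ?_
      obtain ⟨c, rfl⟩ := hγ c
      obtain ⟨c, rfl⟩ := hφ.2 c
      rwa [← hdγ, ← hdφ, hdβ, ← h, ← hdβ, hdφ, hdγ]
    · intro h
      refine hZ _ _ fun c hc => ?_
      obtain ⟨c, rfl⟩ := hβ c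
      rwa [← hdβ, hdφ, hdγ, ← h, ← hdγ, ← hdφ, hdβ]
  choose s hs using hβ
  have hΨ : ∀ p, γ (φ (s (β p))) = γ (φ p) := fun p => (hfib _ _).1 (hs _)
  refine ⟨Equiv.ofBijective (fun P => γ (φ (s P))) ⟨fun P Q h => ?_, fun w => ?_⟩, hΨ,
    fun P Q => ?_⟩
  · rw [← hs P, ← hs Q]
    exact (hfib _ _).2 h
  · obtain ⟨y, rfl⟩ := hγ w
    obtain ⟨x, rfl⟩ := hφ.2 y
    exact ⟨β x, hΨ x⟩
  · change dZ P Q ↔ dW (γ (φ (s P))) (γ (φ (s Q)))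
    rw [← hdγ, ← hdφ, hdβ, hs, hs]

variable {A B : Type*} [Ring A] [Ring B]

open Classical in
/-- Extend a map between projective lines to all submodules by a junk value. -/
noncomputable def extendPoint (φ : PL A → PL B) (p : Submodule A (A × A)) :
    Submodule B (B × B) :=
  if h : IsPoint A p then (φ ⟨p, h⟩).1 else ⊥

theorem extendPoint_coe (φ : PL A → PL B) (p : PL A) : extendPoint φ p.1 = (φ p).1 :=
  dif_pos p.2

theorem isDisIso_extendPoint {φ : PL A → PL B} (hφ : Function.Bijective φ)
    (hd : ∀ p q, Distant p.1 q.1 ↔ Distant (φ p).1 (φ q).1) : IsDisIso (extendPoint φ) := by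
  refine ⟨⟨fun p hp => ?_, fun p hp q hq h => ?_, fun q hq => ?_⟩, fun p q hp hq => ?_⟩
  · have := extendPoint_coe φ ⟨p, hp⟩
    exact this ▸ (φ ⟨p, hp⟩).2
  · have h' : (φ ⟨p, hp⟩).1 = (φ ⟨q, hq⟩).1 := by
      rw [← extendPoint_coe, ← extendPoint_coe]
      exact h
    exact congrArg Subtype.val (hφ.1 (Subtype.ext h'))
  · obtain ⟨p, hp⟩ := hφ.2 ⟨q, hq⟩
    exact ⟨p.1, p.2, by rw [extendPoint_coe, hp]⟩
  · have := hd ⟨p, hp⟩ ⟨q, hq⟩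
    rwa [← extendPoint_coe, ← extendPoint_coe] at this

theorem parallel_iff_of_distant_iff {φ : PL A → PL B} (hφ : Function.Bijective φ)
    (hd : ∀ p q, Distant p.1 q.1 ↔ Distant (φ p).1 (φ q).1) (p q : PL A) :
    Parallel p.1 q.1 ↔ Parallel (φ p).1 (φ q).1 := by
  rw [parallel_iff, parallel_iff, hφ.2.forall]
  simp only [hd]

theorem induced_iff {S T : Type*} [Ring S] [Ring T] (π : A →+* S) (π' : B →+* T)
    [RingHomSurjective π] [RingHomSurjective π'] (φ : PL A → PL B)
    (Φ : Submodule S (S × S) → Submodule T (T × T)) :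
    (∀ (p : PL A) (a b : A), p.1 = Submodule.span A {(a, b)} →
      ∀ a' b' : B, (φ p).1 = Submodule.span B {(a', b')} →
        Φ (Submodule.span S {(π a, π b)}) = Submodule.span T {(π' a', π' b')}) ↔
    ∀ p, Φ (pointMap π p).1 = (pointMap π' (φ p)).1 := by
  constructor
  · intro h p
    obtain ⟨g, hg⟩ := p.2
    obtain ⟨g', hg'⟩ := (φ p).2
    have := h p _ _ hg _ _ hg'
    rwa [← mapPoint_span, ← mapPoint_span, ← hg, ← hg'] at this
  · intro h p a b hp a' b' hp'
    rw [← mapPoint_span, ← mapPoint_span, ← hp, ← hp']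
    exact h p

end Induced

section PiDistant

variable {I : Type*} {R : I → Type*} [∀ i, Ring (R i)]

theorem eq_of_distant_subset (hr : ∀ i, IsRigidDistant fun p q : PL (R i) => Distant p.1 q.1)
    (P Q : PL (Π i, R i)) (h : ∀ C : PL (Π i, R i), Distant C.1 P.1 → Distant C.1 Q.1) :
    P = Q := by
  refine (pointPiEquiv R).injective (eq_of_subset_pi hr _ _ fun C hC => ?_)
  obtain ⟨C, rfl⟩ := (pointPiEquiv R).surjective C
  exact (distant_iff_pointPiEquiv _ _).1 (h C ((distant_iff_pointPiEquiv _ _).2 hC))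

theorem exists_factorization_pi {J : Type*} {R' : J → Type*} [∀ j, Ring (R' j)] [Finite I]
    [Finite J] (hr : ∀ i, IsRigidDistant fun p q : PL (R i) => Distant p.1 q.1)
    (hr' : ∀ j, IsRigidDistant fun p q : PL (R' j) => Distant p.1 q.1)
    (Ψ : PL (Π i, R i) ≃ PL (Π j, R' j))
    (hΨ : ∀ P Q, Distant P.1 Q.1 ↔ Distant (Ψ P).1 (Ψ Q).1) :
    ∃ (σ : I ≃ J) (φ : ∀ k, PL (R k) → PL (R' (σ k))), (∀ k, Function.Bijective (φ k)) ∧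
      (∀ k x y, Distant x.1 y.1 ↔ Distant (φ k x).1 (φ k y).1) ∧
      ∀ P k, pointPiEquiv R' (Ψ P) (σ k) = φ k (pointPiEquiv R P k) := by
  obtain ⟨σ, φ, hbij, hd, h⟩ := exists_factorization hr hr'
    ((pointPiEquiv R).symm.trans (Ψ.trans (pointPiEquiv R'))) fun P Q => by
      rw [← (pointPiEquiv R).apply_symm_apply P, ← (pointPiEquiv R).apply_symm_apply Q,
        ← distant_iff_pointPiEquiv, hΨ, distant_iff_pointPiEquiv]
      simp
  refine ⟨σ, φ, hbij, hd, fun P k => ?_⟩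
  simpa using h (pointPiEquiv R P) k

end PiDistant

/-- Let `R`, `R'` be semilocal rings, i.e. there are surjective ring
homomorphisms `π : R → S`, `π' : R' → S'` with kernel the Jacobson radical onto semisimple
rings `S = Π_{i=1}^m End_{K_i}(U_i)`, `S' = Π_{j=1}^{m'} End_{K'_j}(U'_j)`.  A bijection
`φ : ℙ(R) → ℙ(R')` is a `△`-isomorphism iff it is a `∥`-isomorphism whose induced bijection
`φ̄ : ℙ(S) → ℙ(S')` is a `△`-isomorphism; equivalently, iff it is a `∥`-isomorphism such
that `m = m'` and, for some permutation `σ` of `{1,…,m}`, `(φ̄ P)_{σ k} = φ_k (P_k)` for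
`△`-isomorphisms `φ_k : ℙ(End_{K_k}(U_k)) → ℙ(End_{K'_{σ k}}(U'_{σ k}))`. -/
theorem stmt_17 {R R' : Type*} [Ring R] [Ring R'] {m m' : ℕ} (hm : 0 < m) (hm' : 0 < m')
    {K U : Fin m → Type*} [∀ i, DivisionRing (K i)] [∀ i, AddCommGroup (U i)]
    [∀ i, Module (K i) (U i)] [∀ i, FiniteDimensional (K i) (U i)]
    {K' U' : Fin m' → Type*} [∀ j, DivisionRing (K' j)] [∀ j, AddCommGroup (U' j)]
    [∀ j, Module (K' j) (U' j)] [∀ j, FiniteDimensional (K' j) (U' j)]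
    (hdim : ∀ i, 1 ≤ Module.finrank (K i) (U i))
    (hdim' : ∀ j, 1 ≤ Module.finrank (K' j) (U' j))
    (π : R →+* Π i, EndOp (K i) (U i)) (hπsurj : Function.Surjective π)
    (hπker : ∀ a : R, π a = 0 ↔ a ∈ JacobsonRadical R)
    (π' : R' →+* Π j, EndOp (K' j) (U' j)) (hπ'surj : Function.Surjective π')
    (hπ'ker : ∀ a : R', π' a = 0 ↔ a ∈ JacobsonRadical R')
    (φ : PL R → PL R') (hφbij : Function.Bijective φ) :
    ((∀ p q, (Distant p.1 q.1 ↔ Distant (φ p).1 (φ q).1)) ↔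
      ((∀ p q, (Parallel p.1 q.1 ↔ Parallel (φ p).1 (φ q).1)) ∧
        ∃ Φbar : Submodule (Π i, EndOp (K i) (U i))
            ((Π i, EndOp (K i) (U i)) × (Π i, EndOp (K i) (U i))) →
          Submodule (Π j, EndOp (K' j) (U' j))
            ((Π j, EndOp (K' j) (U' j)) × (Π j, EndOp (K' j) (U' j))),
          (∀ (p : PL R) (a b : R), p.1 = Submodule.span R {(a, b)} →
            ∀ a' b' : R', (φ p).1 = Submodule.span R' {(a', b')} →
            Φbar (Submodule.span (Π i, EndOp (K i) (U i)) {(π a, π b)}) =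
              Submodule.span (Π j, EndOp (K' j) (U' j)) {(π' a', π' b')}) ∧
          IsDisIso Φbar)) ∧
    ((∀ p q, (Distant p.1 q.1 ↔ Distant (φ p).1 (φ q).1)) ↔
      ((∀ p q, (Parallel p.1 q.1 ↔ Parallel (φ p).1 (φ q).1)) ∧
        ∃ Φbar : Submodule (Π i, EndOp (K i) (U i))
            ((Π i, EndOp (K i) (U i)) × (Π i, EndOp (K i) (U i))) →
          Submodule (Π j, EndOp (K' j) (U' j))
            ((Π j, EndOp (K' j) (U' j)) × (Π j, EndOp (K' j) (U' j))),
          (∀ (p : PL R) (a b : R), p.1 = Submodule.span R {(a, b)} →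
            ∀ a' b' : R', (φ p).1 = Submodule.span R' {(a', b')} →
            Φbar (Submodule.span (Π i, EndOp (K i) (U i)) {(π a, π b)}) =
              Submodule.span (Π j, EndOp (K' j) (U' j)) {(π' a', π' b')}) ∧
          (∀ P, IsPoint (Π i, EndOp (K i) (U i)) P →
            IsPoint (Π j, EndOp (K' j) (U' j)) (Φbar P)) ∧
          m = m' ∧
          ∃ σ : Fin m ≃ Fin m',
          ∃ φc : ∀ k : Fin m,
            Submodule (EndOp (K k) (U k)) (EndOp (K k) (U k) × EndOp (K k) (U k)) →
            Submodule (EndOp (K' (σ k)) (U' (σ k)))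
              (EndOp (K' (σ k)) (U' (σ k)) × EndOp (K' (σ k)) (U' (σ k))),
            (∀ k, IsDisIso (φc k)) ∧
            ∀ P, IsPoint (Π i, EndOp (K i) (U i)) P →
              ∀ k, component (Φbar P) (σ k) = φc k (component P k))) := by
  have hπ : RingHomSurjective π := ⟨hπsurj⟩
  have hπ' : RingHomSurjective π' := ⟨hπ'surj⟩
  have hr := fun i => isRigidDistant_endOp (K i) (U i) (hdim i)
  have hr' := fun j => isRigidDistant_endOp (K' j) (U' j) (hdim' j)
  have hdπ := distant_pointMap_iff π fun a => (hπker a).1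
  have hdπ' := distant_pointMap_iff π' fun a => (hπ'ker a).1
  have hsπ := pointMap_surjective π fun a => (hπker a).1
  have hsπ' := pointMap_surjective π' fun a => (hπ'ker a).1
  have hforward := fun hd => exists_induced_equiv hsπ hsπ' hdπ hdπ'
    (eq_of_distant_subset hr) (eq_of_distant_subset hr') hφbij hd
  simp only [induced_iff]
  have hback : ∀ Φbar : Submodule (Π i, EndOp (K i) (U i))
        ((Π i, EndOp (K i) (U i)) × (Π i, EndOp (K i) (U i))) →
      Submodule (Π j, EndOp (K' j) (U' j))
        ((Π j, EndOp (K' j) (U' j)) × (Π j, EndOp (K' j) (U' j))),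
      (∀ p, Φbar (pointMap π p).1 = (pointMap π' (φ p)).1) →
      (∀ P Q, IsPoint _ P → IsPoint _ Q → (Distant P Q ↔ Distant (Φbar P) (Φbar Q))) →
      ∀ p q, Distant p.1 q.1 ↔ Distant (φ p).1 (φ q).1 := by
    intro Φbar h hd p q
    rw [hdπ, hdπ', ← h, ← h]
    exact hd _ _ (pointMap π p).2 (pointMap π q).2
  refine ⟨⟨fun hd => ⟨parallel_iff_of_distant_iff hφbij hd, ?_⟩, ?_⟩,
    ⟨fun hd => ⟨parallel_iff_of_distant_iff hφbij hd, ?_⟩, ?_⟩⟩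
  · obtain ⟨Ψ, hΨ, hdΨ⟩ := hforward hd
    exact ⟨extendPoint Ψ, fun p => by rw [extendPoint_coe, hΨ],
      isDisIso_extendPoint Ψ.bijective hdΨ⟩
  · rintro ⟨-, Φbar, h, -, hd⟩
    exact hback Φbar h hd
  · obtain ⟨Ψ, hΨ, hdΨ⟩ := hforward hd
    obtain ⟨σ, φc, hbij, hdc, hφc⟩ := exists_factorization_pi hr hr' Ψ hdΨ
    refine ⟨extendPoint Ψ, fun p => by rw [extendPoint_coe, hΨ],
      (isDisIso_extendPoint Ψ.bijective hdΨ).1.mapsTo, Fin.equiv_iff_eq.1 ⟨σ⟩, σ,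
      fun k => extendPoint (φc k), fun k => isDisIso_extendPoint (hbij k) (hdc k), ?_⟩
    intro P hP k
    rw [extendPoint_coe Ψ ⟨P, hP⟩]
    have := extendPoint_coe (φc k) (pointPiEquiv _ ⟨P, hP⟩ k)
    rw [pointPiEquiv_apply] at this
    exact (this.trans (by rw [← hφc, pointPiEquiv_apply])).symm
  · rintro ⟨-, Φbar, h, hpt, -, σ, φc, hφc, hcomp⟩
    refine hback Φbar h fun P Q hP hQ => ?_
    rw [distant_iff_component hP hQ, distant_iff_component (hpt P hP) (hpt Q hQ),
      ← σ.forall_congr_right]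
    refine forall_congr' fun k => ?_
    rw [hcomp P hP, hcomp Q hQ]
    exact (hφc k).2 _ _ (hP.mapPoint (Pi.evalRingHom _ k)) (hQ.mapPoint (Pi.evalRingHom _ k))
end

section
/- Let R = ∏_{i=1}^m R_i and R' = ∏_{j=1}^{m'} R'_j where each R_i and each R'_j is a full matrix ring over a (not necessarily commutative) field, and let ω: R → R' be a Jordan isomorphism. Then m = m', and there is a permutation σ of {1,…,m} such that for each x ∈ R and each k ∈ {1,…,m} one has (x^ω)_{σ(k)} = (x_k)^{ω_k}, where each ω_k: R_k → R'_{σ(k)} is either an isomorphism or an anti-isomorphism of rings. -/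
/-- An additive map between rings is a Jordan homomorphism if it preserves `1` and `a * b * a`. -/
structure IsJordanHom {R S : Type*} [Ring R] [Ring S] (φ : R →+ S) : Prop where
  map_one : φ 1 = 1
  map_mul_mul_self : ∀ a b, φ (a * b * a) = φ a * φ b * φ a

/-- A (not necessarily commutative) ring is prime if `x R y = 0` forces `x = 0` or `y = 0`. -/
def IsPrimeRing (R : Type*) [Ring R] : Prop :=
  ∀ x y : R, (∀ r, x * r * y = 0) → x = 0 ∨ y = 0

lemma AddMonoidHom.eq_zero_or_eq_zero_of_forall {A B C : Type*} [AddGroup A] [AddGroup B]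
    [AddGroup C] (f : A →+ B) (g : A →+ C) (h : ∀ a, f a = 0 ∨ g a = 0) :
    (∀ a, f a = 0) ∨ ∀ a, g a = 0 := by
  by_contra! hc
  obtain ⟨⟨a, ha⟩, b, hb⟩ := hc
  have ha' := (h a).resolve_left ha
  have hb' := (h b).resolve_right hb
  rcases h (a + b) with hab | hab
  · rw [map_add, hb', add_zero] at hab
    exact ha hab
  · rw [map_add, ha', zero_add] at hab
    exact hb hab

lemma IsPrimeRing.eq_zero_or_eq_one {R : Type*} [Ring R] (hR : IsPrimeRing R) {e : R}
    (he : e * e = e) (hc : ∀ x, e * x = x * e) : e = 0 ∨ e = 1 := by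
  refine (hR e (1 - e) fun r ↦ ?_).imp_right fun h ↦ (sub_eq_zero.mp h).symm
  rw [hc r, mul_assoc, mul_sub, mul_one, he, sub_self, mul_zero]

lemma IsPrimeRing.op {R : Type*} [Ring R] (hR : IsPrimeRing R) : IsPrimeRing Rᵐᵒᵖ := by
  intro x y h
  refine (hR y.unop x.unop fun r ↦ ?_).symm.imp (fun h ↦ ?_) fun h ↦ ?_
  · simpa [mul_assoc] using congrArg MulOpposite.unop (h (MulOpposite.op r))
  · exact MulOpposite.unop_injective h
  · exact MulOpposite.unop_injective h

lemma Matrix.isPrimeRing {n K : Type*} [Fintype n] [DecidableEq n] [DivisionRing K] :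
    IsPrimeRing (Matrix n n K) := by
  intro x y h
  by_contra! hc
  obtain ⟨hx, hy⟩ := hc
  obtain ⟨i, j, hij⟩ : ∃ i j, x i j ≠ 0 := by
    by_contra! h0
    exact hx (Matrix.ext h0)
  obtain ⟨k, l, hkl⟩ : ∃ k l, y k l ≠ 0 := by
    by_contra! h0
    exact hy (Matrix.ext h0)
  have := congrFun (congrFun (h (Matrix.single j k 1)) i) l
  rw [Matrix.mul_apply, Finset.sum_eq_single k] at this
  · simp [hij, hkl] at this
  · intro b _ hb
    simp [hb]
  · simp

namespace IsJordanHom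

section

variable {R S : Type*} [Ring R] [Ring S] {φ : R →+ S}

lemma map_mul_self (h : IsJordanHom φ) (a : R) : φ (a * a) = φ a * φ a := by
  simpa [h.map_one] using h.map_mul_mul_self a 1

lemma map_mul_add_mul (h : IsJordanHom φ) (a b : R) :
    φ (a * b) + φ (b * a) = φ a * φ b + φ b * φ a := by
  have h1 := h.map_mul_self (a + b)
  simp only [add_mul, mul_add, map_add, h.map_mul_self] at h1
  grind

lemma map_mul_mul_add (h : IsJordanHom φ) (a b c : R) :
    φ (a * b * c) + φ (c * b * a) = φ a * φ b * φ c + φ c * φ b * φ a := by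
  have h1 := h.map_mul_mul_self (a + c) b
  simp only [add_mul, mul_add, map_add, h.map_mul_mul_self] at h1
  grind

lemma defect_mul_mul_defect (h : IsJordanHom φ) (hs : Function.Surjective φ) (a b : R) (r : S) :
    (φ (a * b) - φ a * φ b) * r * (φ (a * b) - φ b * φ a) +
      (φ (a * b) - φ b * φ a) * r * (φ (a * b) - φ a * φ b) = 0 := by
  obtain ⟨r, rfl⟩ := hs r
  have h1 := h.map_mul_mul_add (a * b) r (b * a)
  have h2 := h.map_mul_mul_self a (b * r * b)
  have h3 := h.map_mul_mul_self b (a * r * a)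
  rw [h.map_mul_mul_self b r] at h2
  rw [h.map_mul_mul_self a r] at h3
  rw [show a * b * r * (b * a) = a * (b * r * b) * a by noncomm_ring,
    show b * a * r * (a * b) = b * (a * r * a) * b by noncomm_ring, h2, h3,
    eq_sub_of_add_eq' (h.map_mul_add_mul a b)] at h1
  rw [← sub_eq_zero] at h1
  rw [← h1]
  noncomm_ring

lemma defect_mul_defect (h : IsJordanHom φ) (a b : R) :
    (φ (a * b) - φ a * φ b) * (φ (a * b) - φ b * φ a) = 0 := by
  have h1 := h.map_mul_mul_add a b (a * b)
  have h2 := h.map_mul_mul_self a (b * b)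
  rw [h.map_mul_self] at h2
  rw [← mul_assoc, mul_assoc (a * b) a b, h.map_mul_self,
    show a * b * b * a = a * (b * b) * a by noncomm_ring, h2, ← sub_eq_zero] at h1
  rw [← h1]
  noncomm_ring

lemma op (h : IsJordanHom φ) :
    IsJordanHom ((MulOpposite.opAddEquiv : S ≃+ Sᵐᵒᵖ).toAddMonoidHom.comp φ) where
  map_one := by simp [h.map_one]
  map_mul_mul_self a b := by
    simpa [mul_assoc] using congrArg MulOpposite.op (h.map_mul_mul_self a b)

lemma map_central_idempotent (h : IsJordanHom φ) (hs : Function.Surjective φ)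
    (hS : IsPrimeRing S) {e : R} (he : e * e = e) (hc : ∀ x, e * x = x * e) :
    φ e = 0 ∨ φ e = 1 := by
  have hE : φ e * φ e = φ e := by rw [← h.map_mul_self, he]
  refine hS.eq_zero_or_eq_one hE fun y ↦ ?_
  obtain ⟨x, rfl⟩ := hs y
  have h1 := h.map_mul_mul_self e x
  have h2 := h.map_mul_mul_self (1 - e) x
  rw [show (1 - e) * x * (1 - e) = x - e * x * e by
    simp only [sub_mul, mul_sub, one_mul, mul_one, hc x, mul_assoc, he]
    abel, map_sub, map_sub, h1, h.map_one] at h2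
  have h3 : φ e * (φ x - φ e * φ x * φ e) = φ e * ((1 - φ e) * φ x * (1 - φ e)) := by rw [h2]
  have h4 : (φ x - φ e * φ x * φ e) * φ e = ((1 - φ e) * φ x * (1 - φ e)) * φ e := by rw [h2]
  have h5 : φ e * ((1 - φ e) * φ x * (1 - φ e)) = 0 := by
    rw [← mul_assoc, ← mul_assoc, mul_sub (φ e), hE]
    simp
  have h6 : ((1 - φ e) * φ x * (1 - φ e)) * φ e = 0 := by
    rw [mul_assoc, sub_mul 1 _ (φ e), hE]
    simp
  rw [h5, mul_sub, ← mul_assoc, ← mul_assoc, hE, sub_eq_zero] at h3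
  rw [h6, sub_mul, mul_assoc _ _ (φ e), hE, sub_eq_zero] at h4
  rw [h3, h4]

/-- A Peirce component `e R (1 - e)` is mapped into one of the two opposite Peirce components. -/
lemma peirce_dichotomy (h : IsJordanHom φ) (hs : Function.Surjective φ) (hS : IsPrimeRing S)
    {e : R} (he : e * e = e) :
    (∀ c, φ e * φ (e * c * (1 - e)) = φ (e * c * (1 - e)) ∧
        φ (e * c * (1 - e)) * φ e = 0) ∨
      ∀ c, φ (e * c * (1 - e)) * φ e = φ (e * c * (1 - e)) ∧
        φ e * φ (e * c * (1 - e)) = 0 := by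
  have hE : φ e * φ e = φ e := by rw [← h.map_mul_self, he]
  have key (c : R) (h1 : e * c = c) (h2 : c * e = 0) :
      (φ c - φ e * φ c = 0 ∨ φ c - φ c * φ e = 0) ∧ φ c = φ e * φ c + φ c * φ e := by
    have h3 := h.map_mul_add_mul e c
    rw [h1, h2, map_zero, add_zero] at h3
    refine ⟨hS _ _ fun r ↦ ?_, h3⟩
    have h4 := congrArg ((1 - φ e) * ·) (h.defect_mul_mul_defect hs e c r)
    simp only [h1, mul_add, mul_zero] at h4
    have h5 : (1 - φ e) * (φ c - φ e * φ c) = φ c - φ e * φ c := by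
      rw [mul_sub, sub_mul, sub_mul, ← mul_assoc (φ e) (φ e), hE]
      simp
    have h6 : (1 - φ e) * (φ c - φ c * φ e) = 0 := by
      rw [sub_eq_of_eq_add h3, sub_mul, ← mul_assoc (φ e), hE]
      simp
    rw [← mul_assoc, ← mul_assoc, h5, ← mul_assoc, ← mul_assoc, h6] at h4
    simpa using h4
  have p1 (c : R) : e * (e * c * (1 - e)) = e * c * (1 - e) := by simp only [← mul_assoc, he]
  have p2 (c : R) : e * c * (1 - e) * e = 0 := by rw [mul_assoc, sub_mul, he]; simp
  let P : R →+ S := φ.comp ((AddMonoidHom.mulRight (1 - e)).comp (AddMonoidHom.mulLeft e))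
  have hP (c : R) : P c = φ (e * c * (1 - e)) := rfl
  refine (AddMonoidHom.eq_zero_or_eq_zero_of_forall
    (P - (AddMonoidHom.mulLeft (φ e)).comp P) (P - (AddMonoidHom.mulRight (φ e)).comp P)
    fun c ↦ (key _ (p1 c) (p2 c)).1).imp (fun hh c ↦ ?_) fun hh c ↦ ?_
  all_goals
    have h1 := (key _ (p1 c) (p2 c)).2
    have h2 := hh c
    simp only [AddMonoidHom.sub_apply, AddMonoidHom.comp_apply, AddMonoidHom.coe_mulLeft,
      AddMonoidHom.coe_mulRight, hP, sub_eq_zero] at h2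
    refine ⟨h2.symm, ?_⟩
    rw [← h2] at h1
    first | exact left_eq_add.mp h1 | exact right_eq_add.mp h1

lemma idempotent_dichotomy (h : IsJordanHom φ) (hφ : Function.Bijective φ) (hS : IsPrimeRing S)
    {e : R} (he : e * e = e) :
    (∀ c, φ (e * c) = φ e * φ c) ∨ ∀ c, φ (e * c) = φ c * φ e := by
  have hE : φ e * φ e = φ e := by rw [← h.map_mul_self, he]
  have hf : (1 - e) * (1 - e) = 1 - e := IsIdempotentElem.one_sub he
  have hfe : (1 - φ e) * φ e = 0 := by rw [sub_mul, hE]; simp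
  have hef : φ e * (1 - φ e) = 0 := by rw [mul_sub, hE]; simp
  have hF : φ (1 - e) = 1 - φ e := by rw [map_sub, h.map_one]
  have hec (c : R) : φ (e * c) = φ e * φ c * φ e + φ (e * c * (1 - e)) := by
    rw [← h.map_mul_mul_self, ← map_add]
    congr 1
    noncomm_ring
  have hc (c : R) : φ c = φ (e * c) + φ ((1 - e) * c * e) + (1 - φ e) * φ c * (1 - φ e) := by
    rw [← hF, ← h.map_mul_mul_self, ← map_add, ← map_add]
    congr 1
    noncomm_ring
  have trivial_case (h0 : ∀ x, (1 - φ e) * φ x * φ e = 0 ∨ φ e * φ x * (1 - φ e) = 0) :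
      ∀ c, φ (e * c) = φ e * φ c := by
    have h1 : (∀ x, (1 - φ e) * φ x * φ e = 0) ∨ ∀ x, φ e * φ x * (1 - φ e) = 0 :=
      AddMonoidHom.eq_zero_or_eq_zero_of_forall
        ((AddMonoidHom.mulRight (φ e)).comp ((AddMonoidHom.mulLeft (1 - φ e)).comp φ))
        ((AddMonoidHom.mulRight (1 - φ e)).comp ((AddMonoidHom.mulLeft (φ e)).comp φ)) h0
    have h2 : φ e = 0 ∨ 1 - φ e = 0 := by
      rcases h1 with h1 | h1
      · refine (hS _ _ fun y ↦ ?_).symm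
        obtain ⟨x, rfl⟩ := hφ.2 y
        exact h1 x
      · refine hS _ _ fun y ↦ ?_
        obtain ⟨x, rfl⟩ := hφ.2 y
        exact h1 x
    intro c
    rcases h2 with h2 | h2
    · have : e = 0 := hφ.1 (by rw [h2, map_zero])
      simp [this]
    · have : e = 1 := hφ.1 (by rw [h.map_one, ← sub_eq_zero.mp h2])
      simp [this, h.map_one]
  have d2 : (∀ c, φ e * φ ((1 - e) * c * e) = 0 ∧
        φ ((1 - e) * c * e) * φ e = φ ((1 - e) * c * e)) ∨
      ∀ c, φ ((1 - e) * c * e) * φ e = 0 ∧ φ e * φ ((1 - e) * c * e) = φ ((1 - e) * c * e) := by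
    simpa only [sub_sub_cancel, hF, mul_sub (φ _), sub_mul 1 (φ e), mul_one, one_mul, sub_eq_self,
      sub_eq_zero, eq_comm (a := φ ((1 - e) * _ * e)) (b := _ * φ e),
      eq_comm (a := φ ((1 - e) * _ * e)) (b := φ e * _)] using h.peirce_dichotomy hφ.2 hS hf
  rcases h.peirce_dichotomy hφ.2 hS he with d1 | d1 <;> rcases d2 with d2 | d2
  · refine .inl fun c ↦ ?_
    have h1 := congrArg (φ e * ·) (hc c)
    simp only [hec, mul_add, ← mul_assoc, hE, hef, zero_mul, d1, d2, add_zero] at h1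
    rw [hec]
    exact h1.symm
  · refine .inl (trivial_case fun c ↦ .inl ?_)
    have h1 := congrArg ((1 - φ e) * · * φ e) (hc c)
    have h2 : (1 - φ e) * φ (e * c * (1 - e)) = 0 := by rw [sub_mul, (d1 c).1]; simp
    have h3 : (1 - φ e) * φ ((1 - e) * c * e) = 0 := by rw [sub_mul, (d2 c).2]; simp
    simp only [hec, mul_add, ← mul_assoc, hfe, zero_mul, h2, h3, zero_add] at h1
    simpa only [mul_assoc, hfe, mul_zero] using h1
  · refine .inl (trivial_case fun c ↦ .inr ?_)
    have h1 := congrArg (φ e * · * (1 - φ e)) (hc c)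
    simp only [hec, mul_add, ← mul_assoc, hef, hE, zero_mul, d1, d2, add_zero] at h1
    simpa only [mul_assoc, hef, mul_zero] using h1
  · refine .inr fun c ↦ ?_
    have h1 := congrArg (· * φ e) (hc c)
    simp only [hec, add_mul, mul_assoc _ _ (φ e), hE, hfe, mul_zero, (d1 _).1, (d2 _).1,
      add_zero] at h1
    rw [hec, h1, mul_assoc]

lemma map_mul_of_add_idempotent (h : IsJordanHom φ) (hφ : Function.Bijective φ)
    (hS : IsPrimeRing S) {e x : R} (he : e * e = e) (hm : ∀ c, φ (e * c) = φ e * φ c)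
    (hx : e * x = x ∧ x * e = 0 ∨ e * x = 0 ∧ x * e = x) (c : R) :
    φ (x * c) = φ x * φ c := by
  have hE : φ e * φ e = φ e := by rw [← h.map_mul_self, he]
  have hxx : x * x = 0 := by
    rcases hx with ⟨h1, h2⟩ | ⟨h1, h2⟩
    · rw [← h1, mul_assoc, ← mul_assoc x, h2]; simp
    · rw [← h2, mul_assoc, ← mul_assoc e, h1]; simp
  have hg : (e + x) * (e + x) = e + x := by
    rw [add_mul, mul_add, mul_add, he, hxx]
    rcases hx with ⟨h1, h2⟩ | ⟨h1, h2⟩ <;> simp [h1, h2]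
  rcases h.idempotent_dichotomy hφ hS hg with hd | hd
  · simpa [add_mul, hm] using hd c
  · have h1 := hd e
    have h2 := hm x
    have hx0 : φ x = 0 := by
      rcases hx with ⟨h3, h4⟩ | ⟨h3, h4⟩
      · simpa [add_mul, mul_add, he, h4, hE, ← h2, h3] using h1
      · simpa [add_mul, mul_add, he, h4, hE, ← h2, h3] using h1
    have : x = 0 := hφ.1 (by rw [hx0, map_zero])
    simp [this]

end

lemma matrix_map_mul {ι K S : Type*} [Fintype ι] [DecidableEq ι] [DivisionRing K] [Ring S]
    {φ : Matrix ι ι K →+ S} (h : IsJordanHom φ) (hφ : Function.Bijective φ)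
    (hS : IsPrimeRing S) {i j : ι} (hij : i ≠ j)
    (hm : ∀ c, φ (Matrix.single i i 1 * c) = φ (Matrix.single i i 1) * φ c)
    (a b : Matrix ι ι K) : φ (a * b) = φ a * φ b := by
  have hi : (Matrix.single i i 1 : Matrix ι ι K) * Matrix.single i i 1 = Matrix.single i i 1 := by
    simp
  have row (k : ι) (hk : k ≠ i) (x : K) (c) :
      φ (Matrix.single i k x * c) = φ (Matrix.single i k x) * φ c :=
    h.map_mul_of_add_idempotent hφ hS hi hm (.inl (by simp [hk])) c
  have col (k : ι) (hk : k ≠ i) (x : K) (c) :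
      φ (Matrix.single k i x * c) = φ (Matrix.single k i x) * φ c :=
    h.map_mul_of_add_idempotent hφ hS hi hm (.inr (by simp [hk.symm])) c
  have unit (k l : ι) (x : K) (c) :
      φ (Matrix.single k l x * c) = φ (Matrix.single k l x) * φ c := by
    by_cases hk : k = i
    · subst hk
      by_cases hl : l = k
      · subst hl
        have : (Matrix.single l l x : Matrix ι ι K) =
          Matrix.single l j x * Matrix.single j l 1 := by simp
        rw [this, mul_assoc, row j hij.symm, row j hij.symm, col j hij.symm, mul_assoc]
      · exact row l hl x c
    · by_cases hl : l = i
      · subst hl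
        exact col k hk x c
      · have : (Matrix.single k l x : Matrix ι ι K) =
          Matrix.single k i x * Matrix.single i l 1 := by simp
        rw [this, mul_assoc, col k hk, col k hk, row l hl, mul_assoc]
  rw [Matrix.matrix_eq_sum_single a]
  simp only [Finset.sum_mul, map_sum, unit]

lemma matrix_map_mul_or_map_mul_swap {ι K S : Type*} [Fintype ι] [Nonempty ι] [DecidableEq ι]
    [DivisionRing K] [Ring S] {φ : Matrix ι ι K →+ S} (h : IsJordanHom φ)
    (hφ : Function.Bijective φ) (hS : IsPrimeRing S) :
    (∀ a b, φ (a * b) = φ a * φ b) ∨ ∀ a b, φ (a * b) = φ b * φ a := by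
  rcases subsingleton_or_nontrivial ι with hι | hι
  · have inv (x : Matrix ι ι K) (hx : x ≠ 0) : ∃ y, x * y * x = 1 := by
      obtain ⟨i⟩ := ‹Nonempty ι›
      have hxi : x i i ≠ 0 := fun h0 ↦ hx (Matrix.ext fun k l ↦ by
        rw [Subsingleton.elim k i, Subsingleton.elim l i, h0]; rfl)
      have : Unique ι := ⟨⟨i⟩, fun k ↦ Subsingleton.elim k i⟩
      have hd : (default : ι) = i := Subsingleton.elim _ _
      refine ⟨Matrix.of fun _ _ ↦ (x i i)⁻¹ * (x i i)⁻¹, Matrix.ext fun k l ↦ ?_⟩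
      rw [Subsingleton.elim k i, Subsingleton.elim l i]
      simp [Matrix.mul_apply, hd, hxi]
    have nzd (x y : S) (hxy : x * y = 0) : x = 0 ∨ y = 0 := by
      refine or_iff_not_imp_left.mpr fun hx ↦ ?_
      obtain ⟨x, rfl⟩ := hφ.2 x
      obtain ⟨z, hz⟩ := inv x fun h0 ↦ hx (by rw [h0, map_zero])
      have h1 := h.map_mul_mul_self x z
      rw [hz, h.map_one] at h1
      rw [← one_mul y, h1, mul_assoc, hxy, mul_zero]
    let D : Matrix ι ι K →+ Matrix ι ι K →+ S := AddMonoidHom.mk'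
      (fun a ↦ φ.comp (AddMonoidHom.mulLeft a) - (AddMonoidHom.mulLeft (φ a)).comp φ)
      fun a b ↦ AddMonoidHom.ext fun c ↦ by
        simp [add_mul]
        abel
    let N : Matrix ι ι K →+ Matrix ι ι K →+ S := AddMonoidHom.mk'
      (fun a ↦ φ.comp (AddMonoidHom.mulLeft a) - (AddMonoidHom.mulRight (φ a)).comp φ)
      fun a b ↦ AddMonoidHom.ext fun c ↦ by
        simp [add_mul, mul_add]
        abel
    refine (AddMonoidHom.eq_zero_or_eq_zero_of_forall D N fun a ↦ ?_).imp
      (fun h0 a b ↦ sub_eq_zero.mp (DFunLike.congr_fun (h0 a) b))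
      fun h0 a b ↦ sub_eq_zero.mp (DFunLike.congr_fun (h0 a) b)
    exact (AddMonoidHom.eq_zero_or_eq_zero_of_forall (D a) (N a) fun b ↦
      nzd _ _ (h.defect_mul_defect a b)).imp (AddMonoidHom.ext ·) (AddMonoidHom.ext ·)
  · obtain ⟨i, j, hij⟩ := exists_pair_ne ι
    have hi : (Matrix.single i i 1 : Matrix ι ι K) * Matrix.single i i 1 =
      Matrix.single i i 1 := by simp
    rcases h.idempotent_dichotomy hφ hS hi with hm | hm
    · exact .inl (h.matrix_map_mul hφ hS hij hm)
    · refine .inr fun a b ↦ MulOpposite.op_injective ?_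
      exact h.op.matrix_map_mul ((MulOpposite.opAddEquiv : S ≃+ Sᵐᵒᵖ).bijective.comp hφ) hS.op hij
        (fun c ↦ congrArg MulOpposite.op (hm c)) a b

lemma exists_component {I J : Type*} [Fintype I] [DecidableEq I] {A : I → Type*} {B : J → Type*}
    [∀ i, Ring (A i)] [∀ j, Ring (B j)] [∀ j, Nontrivial (B j)] (hB : ∀ j, IsPrimeRing (B j))
    {ω : (Π i, A i) →+ Π j, B j} (h : IsJordanHom ω) (hω : Function.Surjective ω) (j : J) :
    ∃ i, ∀ x, x i = 0 → ω x j = 0 := by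
  let φ : (Π i, A i) →+ B j := (Pi.evalAddMonoidHom B j).comp ω
  have hφ : IsJordanHom φ :=
    ⟨by simp [φ, h.map_one], fun a b ↦ by simp [φ, h.map_mul_mul_self]⟩
  have hs : Function.Surjective φ := (Function.surjective_eval j).comp hω
  have he (i : I) : φ (Pi.single i 1) = 0 ∨ φ (Pi.single i 1) = 1 := by
    refine hφ.map_central_idempotent hs (hB j) ?_ fun x ↦ ?_
    · rw [← Pi.single_mul, mul_one]
    · rw [← Pi.single_mul_left, ← Pi.single_mul_right, one_mul, mul_one]
  obtain ⟨i, hi⟩ : ∃ i, φ (Pi.single i 1) = 1 := by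
    by_contra! hc
    have h1 : φ (∑ i, Pi.single i 1) = φ 1 := congrArg φ (Finset.univ_sum_single 1)
    rw [map_sum, Finset.sum_eq_zero fun i _ ↦ (he i).resolve_right (hc i), hφ.map_one] at h1
    exact zero_ne_one h1
  refine ⟨i, fun x hx ↦ ?_⟩
  have h1 := hφ.map_mul_mul_self (Pi.single i 1) x
  rw [← Pi.single_mul_left, ← Pi.single_mul, hx, hi] at h1
  simpa [φ] using h1.symm

end IsJordanHom

/-- Let `R = Π_{i=1}^m R_i`, `R' = Π_{j=1}^{m'} R'_j` be direct products
of full matrix rings over (not necessarily commutative) fields, and let `ω : R → R'` be a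
Jordan isomorphism.  Then `m = m'` and there is a permutation `σ` of `{1,…,m}` such that
`(x^ω)_{σ k} = (x_k)^{ω_k}` for maps `ω_k : R_k → R'_{σ k}` each of which is an
isomorphism or an anti-isomorphism of rings. -/
theorem stmt_18 {m m' : ℕ} (hm : 0 < m) (hm' : 0 < m')
    {n : Fin m → ℕ} {n' : Fin m' → ℕ} (hn : ∀ i, 0 < n i) (hn' : ∀ j, 0 < n' j)
    {K : Fin m → Type*} {K' : Fin m' → Type*}
    [∀ i, DivisionRing (K i)] [∀ j, DivisionRing (K' j)]
    (ω : (Π i, Matrix (Fin (n i)) (Fin (n i)) (K i)) →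
      (Π j, Matrix (Fin (n' j)) (Fin (n' j)) (K' j)))
    (hbij : Function.Bijective ω)
    (hadd : ∀ x y, ω (x + y) = ω x + ω y)
    (hone : ω 1 = 1)
    (hjordan : ∀ x y, ω (x * y * x) = ω x * ω y * ω x) :
    m = m' ∧
    ∃ σ : Fin m ≃ Fin m',
    ∃ ωc : ∀ k : Fin m, Matrix (Fin (n k)) (Fin (n k)) (K k) →
        Matrix (Fin (n' (σ k))) (Fin (n' (σ k))) (K' (σ k)),
      (∀ k, Function.Bijective (ωc k) ∧
        (∀ x y, ωc k (x + y) = ωc k x + ωc k y) ∧ ωc k 1 = 1 ∧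
        ((∀ x y, ωc k (x * y) = ωc k x * ωc k y) ∨
          (∀ x y, ωc k (x * y) = ωc k y * ωc k x))) ∧
      ∀ x k, ω x (σ k) = ωc k (x k) := by
  have (i : Fin m) : Nonempty (Fin (n i)) := ⟨⟨0, hn i⟩⟩
  have (j : Fin m') : Nonempty (Fin (n' j)) := ⟨⟨0, hn' j⟩⟩
  let Ω := AddMonoidHom.mk' ω hadd
  have hΩ : IsJordanHom Ω := ⟨hone, hjordan⟩
  let e := AddEquiv.ofBijective Ω hbij
  have hes (y) : ω (e.symm y) = y := e.apply_symm_apply y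
  have hse (x) : e.symm (ω x) = x := e.symm_apply_apply x
  have hΩ' : IsJordanHom e.symm.toAddMonoidHom := by
    refine ⟨hbij.1 ?_, fun a b ↦ hbij.1 ?_⟩
    · exact (hes 1).trans hone.symm
    · exact (hes _).trans (by
        rw [hjordan]
        exact (congrArg₂ _ (congrArg₂ _ (hes a) (hes b)) (hes a)).symm)
  choose τ hτ using hΩ.exists_component (fun j ↦ Matrix.isPrimeRing) hbij.2
  choose ρ hρ using hΩ'.exists_component (fun i ↦ Matrix.isPrimeRing) e.symm.surjective
  replace hρ (k) (x) (hx : ω x (ρ k) = 0) : x k = 0 := by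
    simpa [hse] using hρ k (ω x) hx
  have hτρ (k) : τ (ρ k) = k := by
    by_contra hk
    have h1 := hρ k (Pi.single k 1) (hτ _ _ (Pi.single_eq_of_ne hk _))
    simp at h1
  have hρτ (j) : ρ (τ j) = j := by
    by_contra hj
    have h1 := hτ j (e.symm (Pi.single j 1)) (hρ _ _ (by
      rw [hes, Pi.single_eq_of_ne hj]))
    have h2 : ω (e.symm (Pi.single j 1)) j = 0 := h1
    simp [hes] at h2
  let σ : Fin m ≃ Fin m' := ⟨ρ, τ, hτρ, hρτ⟩
  have hcomp (x) (k) : ω x (σ k) = ω (Pi.single k (x k)) (σ k) := by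
    have h1 := hτ (ρ k) (x - Pi.single k (x k)) (by rw [hτρ]; simp)
    rw [map_sub, Pi.sub_apply, sub_eq_zero] at h1
    exact h1
  refine ⟨Fin.equiv_iff_eq.mp ⟨σ⟩, σ, fun k a ↦ ω (Pi.single k a) (σ k), fun k ↦ ?_, ?_⟩
  · let φ : Matrix (Fin (n k)) (Fin (n k)) (K k) →+
        Matrix (Fin (n' (σ k))) (Fin (n' (σ k))) (K' (σ k)) :=
      (Pi.evalAddMonoidHom _ (σ k)).comp (Ω.comp (AddMonoidHom.single _ k))
    have hφa (a) : φ a = ω (Pi.single k a) (σ k) := rfl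
    have hφ : IsJordanHom φ := by
      refine ⟨?_, fun a b ↦ ?_⟩
      · rw [hφa, ← Pi.one_apply (M := fun i ↦ Matrix (Fin (n i)) (Fin (n i)) (K i)) k, ← hcomp,
          hone, Pi.one_apply]
      · simp only [hφa, Pi.single_mul, hjordan, Pi.mul_apply]
    have hb : Function.Bijective φ := by
      refine ⟨(injective_iff_map_eq_zero φ).mpr fun a ha ↦ ?_, fun b ↦ ?_⟩
      · simpa using hρ k (Pi.single k a) ha
      · obtain ⟨x, hx⟩ := hbij.2 (Pi.single (σ k) b)
        exact ⟨x k, by rw [hφa, ← hcomp, hx, Pi.single_eq_same]⟩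
    exact ⟨hb, map_add φ, hφ.map_one, hφ.matrix_map_mul_or_map_mul_swap hb Matrix.isPrimeRing⟩
  · exact hcomp
end

section
/- Let 𝔐_i = (X_i, ℒ_i) for i ∈ {1,…,m} and 𝔐'_j = (X'_j, ℒ'_j) for j ∈ {1,…,m'} be strongly connected partial linear spaces each having at least one line, where m, m' ≥ 1, and let f: ∏_{i=1}^m X_i → ∏_{j=1}^{m'} X'_j be a collineation of the direct product 𝔐 := ∏_{i=1}^m 𝔐_i onto 𝔐' := ∏_{j=1}^{m'} 𝔐'_j. Then: (1) m = m'; (2) there exist a permutation σ of {1,…,m} and, for each k ∈ {1,…,m}, a collineation f_k: X_k → X'_{σ(k)} such that (f(c₁,…,c_m))_{σ(k)} = f_k(c_k) for all points (c₁,…,c_m) ∈ ∏_{i=1}^m X_i. -/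
/-- A partial linear space (given by its set of lines on a point type): every line has at
least two points, and two distinct points lie on at most one common line. -/
def IsPLS {X : Type*} (L : Set (Set X)) : Prop :=
  (∀ l ∈ L, ∃ p q : X, p ∈ l ∧ q ∈ l ∧ p ≠ q) ∧
  (∀ l₁ ∈ L, ∀ l₂ ∈ L, ∀ p q : X,
    p ≠ q → p ∈ l₁ → q ∈ l₁ → p ∈ l₂ → q ∈ l₂ → l₁ = l₂)

/-- A strong subspace: a set of mutually collinear points closed under lines. -/
def IsStrongSubspace {X : Type*} (L : Set (Set X)) (S : Set X) : Prop :=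
  (∀ p ∈ S, ∀ q ∈ S, p ≠ q → ∃ l ∈ L, p ∈ l ∧ q ∈ l) ∧
  (∀ l ∈ L, (∃ p ∈ l ∩ S, ∃ q ∈ l ∩ S, p ≠ q) → l ⊆ S)

/-- Strong connectedness: every point can be reached from every strong subspace with more
than one point by a finite chain of strong subspaces, consecutive ones meeting in at least
two points. -/
def IsStronglyConnected {X : Type*} (L : Set (Set X)) : Prop :=
  ∀ (p : X) (S : Set X), IsStrongSubspace L S → S.Nontrivial →
    ∃ (b : ℕ) (c : ℕ → Set X), c 0 = S ∧ p ∈ c b ∧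
      (∀ i ≤ b, IsStrongSubspace L (c i)) ∧
      (∀ i, 1 ≤ i → i ≤ b → (c (i - 1) ∩ c i).Nontrivial)

/-- The lines of the direct (Segre) product of partial linear spaces: one coordinate runs
over a line of the corresponding space, all other coordinates are fixed. -/
def prodLines {m : ℕ} {X : Fin m → Type*} (L : ∀ i, Set (Set (X i))) :
    Set (Set (∀ i, X i)) :=
  {S | ∃ (j : Fin m) (lj : Set (X j)) (c : ∀ i, X i), lj ∈ L j ∧
    S = {x | x j ∈ lj ∧ ∀ i, i ≠ j → x i = c i}}

/-- A collineation: a bijection of the point sets mapping lines onto lines in both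
directions. -/
def IsCollineation {X Y : Type*} (LX : Set (Set X)) (LY : Set (Set Y)) (f : X → Y) : Prop :=
  Function.Bijective f ∧ (∀ l ∈ LX, f '' l ∈ LY) ∧ (∀ l' ∈ LY, f ⁻¹' l' ∈ LX)

/-- Two points of a product agree in every coordinate other than `j`. -/
def AgreeOff {ι : Type*} {X : ι → Type*} (j : ι) (x y : ∀ i, X i) : Prop :=
  ∀ i, i ≠ j → x i = y i

namespace AgreeOff

variable {ι : Type*} {X : ι → Type*} {i j : ι} {x y z : ∀ i, X i}

theorem refl (j : ι) (x : ∀ i, X i) : AgreeOff j x x := fun _ _ => rfl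

theorem symm (h : AgreeOff j x y) : AgreeOff j y x := fun i hi => (h i hi).symm

theorem trans (h : AgreeOff j x y) (h' : AgreeOff j y z) : AgreeOff j x z :=
  fun i hi => (h i hi).trans (h' i hi)

theorem apply_ne (h : AgreeOff j x y) (hne : x ≠ y) : x j ≠ y j := fun e =>
  hne (funext fun i => by
    by_cases hi : i = j
    · subst hi; exact e
    · exact h i hi)

theorem index_unique (h : AgreeOff i x y) (h' : AgreeOff j x y) (hne : x ≠ y) : i = j := by
  by_contra hij
  exact h.apply_ne hne (h' i hij)

theorem update_left [DecidableEq ι] (j : ι) (x : ∀ i, X i) (a : X j) :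
    AgreeOff j (Function.update x j a) x :=
  fun _ hi => Function.update_of_ne hi _ _

/-- Three points, pairwise differing in at most one coordinate, differ in a common one. -/
theorem of_triangle {k l : ι} (hxy : AgreeOff j x y) (hne : x ≠ y)
    (hzx : AgreeOff k z x) (hzy : AgreeOff l z y) : AgreeOff j z x := by
  by_cases hk : k = j
  · exact hk ▸ hzx
  by_cases hl : l = j
  · exact (hl ▸ hzy).trans hxy.symm
  · exact absurd ((hzx j (Ne.symm hk)).symm.trans (hzy j (Ne.symm hl))) (hxy.apply_ne hne)

/-- A function on a finite product which does not change when a single coordinate changes is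
constant. -/
theorem eq_of_forall [Finite ι] {Y : Type*} {F : (∀ i, X i) → Y}
    (hF : ∀ k c d, AgreeOff k c d → F c = F d) (c d : ∀ i, X i) : F c = F d := by
  classical
  have := Fintype.ofFinite ι
  have key : ∀ s : Finset ι, F (s.piecewise c d) = F d := by
    intro s
    induction s using Finset.induction_on with
    | empty => simp
    | insert a s _ ih =>
      rw [Finset.piecewise_insert, ← ih]
      exact hF a _ _ (update_left a _ _)
  simpa using key Finset.univ

end AgreeOff

theorem IsPLS.isStrongSubspace {X : Type*} {L : Set (Set X)} (h : IsPLS L) {l : Set X}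
    (hl : l ∈ L) : IsStrongSubspace L l := by
  refine ⟨fun p hp q hq _ => ⟨l, hl, hp, hq⟩, ?_⟩
  rintro l' hl' ⟨p, ⟨hp', hp⟩, q, ⟨hq', hq⟩, hne⟩
  rw [h.2 l' hl' l hl p q hne hp' hq' hp hq]

theorem IsPLS.nontrivial {X : Type*} {L : Set (Set X)} (h : IsPLS L) (hL : L.Nonempty) :
    Nontrivial X := by
  obtain ⟨l, hl⟩ := hL
  obtain ⟨p, q, -, -, hne⟩ := h.1 l hl
  exact ⟨p, q, hne⟩

theorem IsCollineation.symm {X Y : Type*} {LX : Set (Set X)} {LY : Set (Set Y)} {f : X → Y}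
    (h : IsCollineation LX LY f) :
    IsCollineation LY LX (Equiv.ofBijective f h.1).symm := by
  refine ⟨Equiv.bijective _, fun l hl => ?_, fun l hl => ?_⟩
  · rw [Equiv.image_symm_eq_preimage]
    exact h.2.2 l hl
  · rw [← Equiv.image_eq_preimage_symm]
    exact h.2.1 l hl

section Product

variable {m m' : ℕ} {X : Fin m → Type*} {X' : Fin m' → Type*}
  {L : ∀ i, Set (Set (X i))} {L' : ∀ j, Set (Set (X' j))}
  {f : (∀ i, X i) → (∀ j, X' j)}

/-- The points of the product with `j`-th coordinate in `l` that agree with `c` elsewhere. -/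
def axisSet (j : Fin m) (l : Set (X j)) (c : ∀ i, X i) : Set (∀ i, X i) :=
  {x | x j ∈ l ∧ AgreeOff j x c}

theorem axisSet_mem_prodLines {j : Fin m} {l : Set (X j)} (hl : l ∈ L j) (c : ∀ i, X i) :
    axisSet j l c ∈ prodLines L :=
  ⟨j, l, c, hl, rfl⟩

theorem mem_of_axisSet_mem_prodLines {j : Fin m} {l : Set (X j)} (hl : l.Nontrivial)
    {c : ∀ i, X i} (h : axisSet j l c ∈ prodLines L) : l ∈ L j := by
  obtain ⟨k, l', d, hl', heq⟩ := h
  change axisSet j l c = axisSet k l' d at heq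
  have hmem : ∀ a ∈ l, Function.update c j a ∈ axisSet k l' d := fun a ha =>
    heq ▸ ⟨by simpa using ha, AgreeOff.update_left j c a⟩
  obtain ⟨a, ha, b, hb, hab⟩ := hl
  have hne : Function.update c j a ≠ Function.update c j b :=
    fun e => hab (Function.update_injective c j e)
  have hjk : j = k := AgreeOff.index_unique
    ((AgreeOff.update_left j c a).trans (AgreeOff.update_left j c b).symm)
    ((hmem a ha).2.trans (hmem b hb).2.symm) hne
  subst hjk
  suffices l = l' from this ▸ hl'
  ext x
  constructor
  · intro hx
    simpa using (hmem x hx).1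
  · intro hx
    have : Function.update c j x ∈ axisSet j l' d :=
      ⟨by simpa using hx, ((AgreeOff.update_left j c x).trans
        (AgreeOff.update_left j c a).symm).trans (hmem a ha).2⟩
    rw [← heq] at this
    simpa using this.1

theorem exists_agreeOff_image (hf : ∀ l ∈ prodLines L, f '' l ∈ prodLines L') {i : Fin m}
    {x y : ∀ i, X i} (hxy : AgreeOff i x y) {l : Set (X i)} (hl : l ∈ L i) (hx : x i ∈ l)
    (hy : y i ∈ l) : ∃ j, AgreeOff j (f x) (f y) := by
  obtain ⟨j, l', d, -, heq⟩ := hf _ (axisSet_mem_prodLines hl y)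
  have hx' : f x ∈ f '' axisSet i l y := ⟨x, ⟨hx, hxy⟩, rfl⟩
  have hy' : f y ∈ f '' axisSet i l y := ⟨y, ⟨hy, AgreeOff.refl i y⟩, rfl⟩
  rw [heq] at hx' hy'
  exact ⟨j, AgreeOff.trans hx'.2 (AgreeOff.symm hy'.2)⟩

/-- A coordinate fibre over a strongly connected factor is mapped into a coordinate fibre. -/
theorem exists_fibre_image_subset (hpls : ∀ i, IsPLS (L i))
    (hsc : ∀ i, IsStronglyConnected (L i)) (hline : ∀ i, (L i).Nonempty)
    (hf : IsCollineation (prodLines L) (prodLines L') f) (i : Fin m) (c : ∀ i, X i) :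
    ∃ j, ∀ x, AgreeOff i x c → AgreeOff j (f x) (f c) := by
  obtain ⟨l, hl⟩ := hline i
  obtain ⟨p, q, hp, hq, hpq⟩ := (hpls i).1 l hl
  have hinj : Function.Injective fun a => f (Function.update c i a) :=
    hf.1.injective.comp (Function.update_injective c i)
  have hcol : ∀ S, IsStrongSubspace (L i) S → ∀ a ∈ S, ∀ b ∈ S,
      ∃ j, AgreeOff j (f (Function.update c i a)) (f (Function.update c i b)) := by
    intro S hS a ha b hb
    by_cases hab : a = b
    · subst hab
      obtain ⟨j, -⟩ := exists_agreeOff_image hf.2.1 (AgreeOff.refl i (Function.update c i p)) hl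
        (by simpa using hp) (by simpa using hp)
      exact ⟨j, AgreeOff.refl _ _⟩
    · obtain ⟨l', hl', ha', hb'⟩ := hS.1 a ha b hb hab
      exact exists_agreeOff_image hf.2.1
        ((AgreeOff.update_left i c a).trans (AgreeOff.update_left i c b).symm) hl'
        (by simpa using ha') (by simpa using hb')
  have hstrong := (hpls i).isStrongSubspace hl
  obtain ⟨j, hj⟩ := hcol l hstrong p hp q hq
  have step : ∀ S, IsStrongSubspace (L i) S → ∀ u ∈ S, ∀ v ∈ S, u ≠ v →
      AgreeOff j (f (Function.update c i u)) (f (Function.update c i p)) →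
      AgreeOff j (f (Function.update c i v)) (f (Function.update c i p)) →
      ∀ a ∈ S, AgreeOff j (f (Function.update c i a)) (f (Function.update c i p)) := by
    intro S hS u hu v hv huv hup hvp a ha
    obtain ⟨k, hk⟩ := hcol S hS a ha u hu
    obtain ⟨k', hk'⟩ := hcol S hS a ha v hv
    exact (AgreeOff.of_triangle (hup.trans hvp.symm) (hinj.ne huv) hk hk').trans hup
  have all : ∀ a, AgreeOff j (f (Function.update c i a)) (f (Function.update c i p)) := by
    intro a
    obtain ⟨b, S, h0, hb, hS, hmeet⟩ := hsc i a l hstrong ⟨p, hp, q, hq, hpq⟩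
    have chain : ∀ n ≤ b, ∀ a ∈ S n,
        AgreeOff j (f (Function.update c i a)) (f (Function.update c i p)) := by
      intro n
      induction n with
      | zero =>
        intro _
        rw [h0]
        exact step l hstrong p hp q hq hpq (AgreeOff.refl _ _) hj.symm
      | succ n ih =>
        intro hn
        obtain ⟨u, hu, v, hv, huv⟩ := hmeet (n + 1) (by omega) hn
        exact step _ (hS _ hn) u hu.2 v hv.2 huv (ih (by omega) u hu.1) (ih (by omega) v hv.1)
    exact chain b le_rfl a hb
  refine ⟨j, fun x hx => ?_⟩
  have hx' : Function.update c i (x i) = x := by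
    ext k
    by_cases hk : k = i
    · subst hk; simp
    · simp [hk, hx k hk]
  have h₁ := all (x i)
  have h₂ := all (c i)
  rw [hx'] at h₁
  rw [Function.update_eq_self] at h₂
  exact h₁.trans h₂.symm

end Product

section Hamming

variable {ι ι' : Type*} {X : ι → Type*} {X' : ι' → Type*} {f : (∀ i, X i) → (∀ j, X' j)}

/-- If an injection maps coordinate fibres to coordinate fibres, then the directions of the
images of parallel fibres agree. -/
theorem fibre_direction_eq [∀ i, Nontrivial (X i)] (hinj : Function.Injective f)
    {s : ι → (∀ i, X i) → ι'}
    (hs : ∀ i c x, AgreeOff i x c ↔ AgreeOff (s i c) (f x) (f c))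
    (i k : ι) (c d : ∀ i, X i) (hcd : AgreeOff k c d) : s i c = s i d := by
  classical
  by_cases hne : c = d
  · rw [hne]
  by_cases hik : k = i
  · subst hik
    exact AgreeOff.index_unique ((hs k c d).1 hcd.symm).symm ((hs k d c).1 hcd) (hinj.ne hne)
  by_contra hst
  obtain ⟨a, ha⟩ := exists_ne (c i)
  set c' := Function.update c i a with hc'
  set d' := Function.update d i a with hd'
  have hcc' : AgreeOff i c' c := AgreeOff.update_left i c a
  have hdd' : AgreeOff i d' d := AgreeOff.update_left i d a
  have hcd' : AgreeOff k c' d' := by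
    intro n hn
    by_cases hni : n = i
    · subst hni; simp [hc', hd']
    · rw [hcc' n hni, hdd' n hni, hcd n hn]
  have hck : c k ≠ d k := hcd.apply_ne hne
  have h₁ := (hs i c c').1 hcc'
  have h₂ := (hs i d d').1 hdd'
  have h₃ := ((hs k d c).1 hcd)
  have h₄ := ((hs k d' c').1 hcd')
  have hcc : c' ≠ c := fun e => ha (by simpa [hc'] using congrFun e i)
  have h₁ne := h₁.apply_ne (hinj.ne hcc)
  have hd₁ : s k d ≠ s i c := fun e => by
    rw [e] at h₃
    exact hck ((hs i c d).2 h₃.symm k hik).symm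
  have hd₂ : s k d' ≠ s i c := fun e => by
    rw [e] at h₄
    have := (hs i c d').2 (h₄.symm.trans h₁) k hik
    rw [hdd' k hik] at this
    exact hck this.symm
  exact h₁ne (by
    rw [h₄ _ hd₂.symm, h₂ _ hst, h₃ _ hd₁.symm])

/-- A bijection between finite products of nontrivial factors mapping coordinate fibres onto
coordinate fibres permutes the coordinates. -/
theorem exists_equiv_agreeOff [Finite ι] [∀ i, Nontrivial (X i)] [∀ j, Nontrivial (X' j)]
    (hf : Function.Bijective f)
    (h : ∀ i c, ∃ j, ∀ x, AgreeOff i x c ↔ AgreeOff j (f x) (f c)) :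
    ∃ σ : ι ≃ ι', ∀ i c x, AgreeOff i x c ↔ AgreeOff (σ i) (f x) (f c) := by
  classical
  choose s hs using h
  let c₀ : ∀ i, X i := fun i => Classical.arbitrary (X i)
  have hconst : ∀ i c, s i c = s i c₀ := fun i c =>
    AgreeOff.eq_of_forall (F := s i) (fun k => fibre_direction_eq hf.injective hs i k) c c₀
  have hs' : ∀ i c x, AgreeOff i x c ↔ AgreeOff (s i c₀) (f x) (f c) := fun i c x =>
    hconst i c ▸ hs i c x
  have hbij : Function.Bijective fun i => s i c₀ := by
    constructor
    · intro i k hik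
      obtain ⟨a, ha⟩ := exists_ne (c₀ i)
      have h₁ := AgreeOff.update_left i c₀ a
      have h₂ := (hs' i c₀ _).1 h₁
      simp only at hik
      rw [hik] at h₂
      exact AgreeOff.index_unique h₁ ((hs' k c₀ _).2 h₂)
        fun e => ha (by simpa using congrFun e i)
    · intro j
      by_contra! hj
      obtain ⟨b, hb⟩ := exists_ne (f c₀ j)
      obtain ⟨d, hd⟩ := hf.surjective (Function.update (f c₀) j b)
      have : f d j = f c₀ j := AgreeOff.eq_of_forall (F := fun c => f c j)
        (fun k c d hcd => (hs' k d c).1 hcd j (hj k).symm) d c₀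
      rw [hd, Function.update_self] at this
      exact hb this
  exact ⟨Equiv.ofBijective _ hbij, hs'⟩

end Hamming

/-- Let `𝔐_i` (`1 ≤ i ≤ m`) and `𝔐'_j` (`1 ≤ j ≤ m'`), `m, m' ≥ 1`, be
strongly connected partial linear spaces with at least one line, and let `f` be a
collineation of `Π 𝔐_i` onto `Π 𝔐'_j`.  Then `m = m'` and there are a permutation `σ` of
`{1,…,m}` and collineations `f_k : X_k → X'_{σ k}` with `(f c)_{σ k} = f_k (c_k)` for all
points `c`. -/
theorem stmt_19 {m m' : ℕ} (hm : 0 < m) (hm' : 0 < m')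
    {X : Fin m → Type*} {X' : Fin m' → Type*}
    (L : ∀ i, Set (Set (X i))) (L' : ∀ j, Set (Set (X' j)))
    (hpls : ∀ i, IsPLS (L i)) (hpls' : ∀ j, IsPLS (L' j))
    (hsc : ∀ i, IsStronglyConnected (L i)) (hsc' : ∀ j, IsStronglyConnected (L' j))
    (hline : ∀ i, (L i).Nonempty) (hline' : ∀ j, (L' j).Nonempty)
    (f : (∀ i, X i) → (∀ j, X' j))
    (hf : IsCollineation (prodLines L) (prodLines L') f) :
    m = m' ∧
    ∃ σ : Fin m ≃ Fin m',
    ∃ fc : ∀ k : Fin m, X k → X' (σ k),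
      (∀ k, IsCollineation (L k) (L' (σ k)) (fc k)) ∧
      ∀ (c : ∀ i, X i) (k : Fin m), f c (σ k) = fc k (c k) := by
  have hnt : ∀ i, Nontrivial (X i) := fun i => (hpls i).nontrivial (hline i)
  have hnt' : ∀ j, Nontrivial (X' j) := fun j => (hpls' j).nontrivial (hline' j)
  have hfib : ∀ i c, ∃ j, ∀ x, AgreeOff i x c ↔ AgreeOff j (f x) (f c) := by
    intro i c
    obtain ⟨j, hj⟩ := exists_fibre_image_subset hpls hsc hline hf i c
    obtain ⟨k, hk⟩ := exists_fibre_image_subset hpls' hsc' hline' hf.symm j (f c)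
    have hk' : ∀ x, AgreeOff j (f x) (f c) → AgreeOff k x c := fun x hx => by
      simpa only [Equiv.ofBijective_symm_apply_apply] using hk (f x) hx
    obtain ⟨a, ha⟩ := exists_ne (c i)
    have hik : i = k := AgreeOff.index_unique (AgreeOff.update_left i c a)
      (hk' _ (hj _ (AgreeOff.update_left i c a))) fun e => ha (by simpa using congrFun e i)
    subst hik
    exact ⟨j, fun x => ⟨hj x, hk' x⟩⟩
  obtain ⟨σ, hσ⟩ := exists_equiv_agreeOff hf.1 hfib
  let c₀ : ∀ i, X i := fun i => Classical.arbitrary (X i)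
  let fc : ∀ k : Fin m, X k → X' (σ k) := fun k x => f (Function.update c₀ k x) (σ k)
  have hfc : ∀ (c : ∀ i, X i) (k : Fin m), f c (σ k) = fc k (c k) := by
    intro c k
    have := AgreeOff.eq_of_forall (F := fun d => f (Function.update d k (c k)) (σ k))
      (fun i d e hde => by
        by_cases hik : i = k
        · subst hik
          have : Function.update d i (c i) = Function.update e i (c i) := by
            ext n
            by_cases hn : n = i
            · subst hn; simp
            · simp [hn, hde n hn]
          simp only [this]
        · refine (hσ i _ _).1 (fun n hn => ?_) (σ k) fun e => hik (σ.injective e).symm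
          by_cases hnk : n = k
          · subst hnk; simp
          · simp [hnk, hde n hn]) c c₀
    simpa using this
  have hbij : ∀ k, Function.Bijective (fc k) := by
    intro k
    constructor
    · intro x y hxy
      have hag := (hσ k _ _).1
        ((AgreeOff.update_left k c₀ x).trans (AgreeOff.update_left k c₀ y).symm)
      by_contra hne
      exact hag.apply_ne (hf.1.injective.ne
        fun e => hne (Function.update_injective c₀ k e)) hxy
    · intro y
      obtain ⟨d, hd⟩ := hf.1.surjective (Function.update (f c₀) (σ k) y)
      exact ⟨d k, by rw [← hfc, hd, Function.update_self]⟩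
  have hpre : ∀ k (l' : Set (X' (σ k))),
      f ⁻¹' axisSet (σ k) l' (f c₀) = axisSet k (fc k ⁻¹' l') c₀ := by
    intro k l'
    ext x
    change (f x (σ k) ∈ l' ∧ AgreeOff (σ k) (f x) (f c₀)) ↔ (fc k (x k) ∈ l' ∧ AgreeOff k x c₀)
    rw [hfc, hσ k]
  refine ⟨by simpa using Fintype.card_congr σ, σ, fc, fun k => ⟨hbij k, fun l hl => ?_,
    fun l' hl' => ?_⟩, hfc⟩
  · obtain ⟨p, q, hp, hq, hne⟩ := (hpls k).1 l hl
    have hnon : l.Nontrivial := ⟨p, hp, q, hq, hne⟩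
    have hmem := hf.2.1 _ (axisSet_mem_prodLines hl c₀)
    have himg := hpre k (fc k '' l)
    rw [Set.preimage_image_eq _ (hbij k).injective] at himg
    rw [← himg, Set.image_preimage_eq _ hf.1.surjective] at hmem
    exact mem_of_axisSet_mem_prodLines (hnon.image (hbij k).injective) hmem
  · obtain ⟨p, q, hp, hq, hne⟩ := (hpls' (σ k)).1 l' hl'
    have hnon : l'.Nontrivial := ⟨p, hp, q, hq, hne⟩
    have hmem := hf.2.2 _ (axisSet_mem_prodLines hl' (f c₀))
    rw [hpre] at hmem
    exact mem_of_axisSet_mem_prodLines (hnon.preimage (hbij k).surjective) hmem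
end
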